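/- Let E be a closed real-linear subspace of S₂(H) with [X, [X, Y]] ∈ E for all X, Y ∈ E. Then for every p ∈ P there exists a unique π(p) ∈ exp E such that d(p, π(p)) = inf{ d(p, e) : e ∈ exp E }; i.e., the nearest-point projection from P onto the closed geodesic subspace exp E exists. -/

import Mathlib

noncomputable section

open scoped InnerProductSpace

variable {H : Type*} [NormedAddCommGroup H] [InnerProductSpace ℂ H] [CompleteSpace H]
variable {ι : Type*}

/-- `A` is a Hilbert–Schmidt operator (w.r.t. the Hilbert basis `e`). -/
def IsHS (e : HilbertBasis ι ℂ H) (A : H →L[ℂ] H) : Prop :=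
  Summable fun i => ‖A (e i)‖ ^ 2

/-- The Hilbert–Schmidt norm of `A` (w.r.t. the Hilbert basis `e`). -/
def hsNorm (e : HilbertBasis ι ℂ H) (A : H →L[ℂ] H) : ℝ :=
  Real.sqrt (∑' i, ‖A (e i)‖ ^ 2)

/-- The real Hilbert–Schmidt inner product `⟨A, B⟩₂ = ∑ ⟪A eᵢ, B eᵢ⟫`. -/
def hsInner (e : HilbertBasis ι ℂ H) (A B : H →L[ℂ] H) : ℝ :=
  (∑' i, (inner ℂ (A (e i)) (B (e i)) : ℂ)).re

/-- The trace of an operator, `Tr T = ∑ ⟪eᵢ, T eᵢ⟫`. -/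
def opTrace (e : HilbertBasis ι ℂ H) (T : H →L[ℂ] H) : ℂ :=
  ∑' i, (inner ℂ (e i) (T (e i)) : ℂ)

/-- `T` is trace class: it is the product of two Hilbert–Schmidt operators. -/
def IsTraceClass (e : HilbertBasis ι ℂ H) (T : H →L[ℂ] H) : Prop :=
  ∃ B C : H →L[ℂ] H, IsHS e B ∧ IsHS e C ∧ T = B * C

/-- `A ∈ S₂(H)`: self-adjoint and Hilbert–Schmidt. -/
def MemS2 (e : HilbertBasis ι ℂ H) (A : H →L[ℂ] H) : Prop :=
  IsSelfAdjoint A ∧ IsHS e A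

/-- `p ∈ P`: self-adjoint, positive definite (invertible and `⟪p x, x⟫ ≥ 0`),
with `p - 1` Hilbert–Schmidt. -/
def MemP (e : HilbertBasis ι ℂ H) (p : H →L[ℂ] H) : Prop :=
  IsSelfAdjoint p ∧ IsUnit p ∧ (∀ x : H, 0 ≤ (inner ℂ (p x) x : ℂ).re) ∧ IsHS e (p - 1)

/-- `x ∈ GL₂(H)`: invertible with `x - 1` Hilbert–Schmidt. -/
def MemGL2 (e : HilbertBasis ι ℂ H) (x : H →L[ℂ] H) : Prop :=
  IsUnit x ∧ IsHS e (x - 1)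

/-- `x ∈ U₂(H)`: unitary with `x - 1` Hilbert–Schmidt. -/
def MemU2 (e : HilbertBasis ι ℂ H) (x : H →L[ℂ] H) : Prop :=
  x ∈ unitary (H →L[ℂ] H) ∧ IsHS e (x - 1)

/-- `p^{1/2}`, via continuous functional calculus. -/
def psqrt (p : H →L[ℂ] H) : H →L[ℂ] H := cfc Real.sqrt p

/-- `p^{-1/2}`, via continuous functional calculus. -/
def pinvsqrt (p : H →L[ℂ] H) : H →L[ℂ] H := cfc (fun t : ℝ => (Real.sqrt t)⁻¹) p

/-- `log p`, via continuous functional calculus. -/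
def plog (p : H →L[ℂ] H) : H →L[ℂ] H := cfc Real.log p

/-- The geodesic distance `d(p, q) = ‖log (p^{-1/2} q p^{-1/2})‖₂`. -/
def gdist (e : HilbertBasis ι ℂ H) (p q : H →L[ℂ] H) : ℝ :=
  hsNorm e (plog (pinvsqrt p * q * pinvsqrt p))

/-- The commutator `[A, B] = AB - BA`. -/
def brk (A B : H →L[ℂ] H) : H →L[ℂ] H := A * B - B * A

/-- The constant-speed geodesic `t ↦ p^{1/2} exp(t K) p^{1/2}`. -/
def geoCurve (p K : H →L[ℂ] H) (t : ℝ) : H →L[ℂ] H :=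
  psqrt p * NormedSpace.exp (t • K) * psqrt p

/-- The geodesic from `p` to `q`:
`t ↦ p^{1/2} exp(t log(p^{-1/2} q p^{-1/2})) p^{1/2}`. -/
def geodesic (p q : H →L[ℂ] H) (t : ℝ) : H →L[ℂ] H :=
  geoCurve p (plog (pinvsqrt p * q * pinvsqrt p)) t

/-- The image `exp E` of a set of operators under the exponential map. -/
def expSet (E : Set (H →L[ℂ] H)) : Set (H →L[ℂ] H) := NormedSpace.exp '' E

/-- The orthogonal complement of `E` inside `S₂(H)` for the Hilbert–Schmidt
inner product. -/
def hsPerp (e : HilbertBasis ι ℂ H) (E : Set (H →L[ℂ] H)) : Set (H →L[ℂ] H) :=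
  {Y | MemS2 e Y ∧ ∀ X ∈ E, hsInner e X Y = 0}

/-- `E` is closed in `S₂(H)` with respect to the Hilbert–Schmidt norm. -/
def IsHSClosed (e : HilbertBasis ι ℂ H) (E : Set (H →L[ℂ] H)) : Prop :=
  ∀ X : H →L[ℂ] H, MemS2 e X → (∀ ε > (0:ℝ), ∃ Y ∈ E, hsNorm e (X - Y) < ε) → X ∈ E


/-! ### Even power series in a real Banach algebra -/

section EvenSeries

set_option linter.unusedSectionVars false

open scoped Nat

variable {𝔸 : Type*} [NormedRing 𝔸] [NormedAlgebra ℝ 𝔸] [CompleteSpace 𝔸]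

theorem rexp_add {x y : 𝔸} (h : Commute x y) :
    NormedSpace.exp (x + y) = NormedSpace.exp x * NormedSpace.exp y := by
  let _ := NormedAlgebra.restrictScalars ℚ ℝ 𝔸
  exact NormedSpace.exp_add_of_commute h

theorem rexp_continuous : Continuous (NormedSpace.exp : 𝔸 → 𝔸) := by
  let _ := NormedAlgebra.restrictScalars ℚ ℝ 𝔸
  exact NormedSpace.exp_continuous

theorem rexp_neg_mul (x : 𝔸) : NormedSpace.exp (-x) * NormedSpace.exp x = 1 := by
  rw [← rexp_add (Commute.refl x).neg_left]; simp

theorem rexp_mul_neg (x : 𝔸) : NormedSpace.exp x * NormedSpace.exp (-x) = 1 := by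
  rw [← rexp_add (Commute.refl x).neg_right]; simp

theorem rexp_smul_add (s t : ℝ) (x : 𝔸) :
    NormedSpace.exp ((s + t) • x) = NormedSpace.exp (s • x) * NormedSpace.exp (t • x) := by
  rw [add_smul, rexp_add]
  exact ((Commute.refl x).smul_left s).smul_right t

theorem rexp_isUnit (x : 𝔸) : IsUnit (NormedSpace.exp x) :=
  ⟨⟨_, _, rexp_mul_neg x, rexp_neg_mul x⟩, rfl⟩

/-- coefficients dominated by those of `cosh`. -/
def CoefOK (c : ℕ → ℝ) : Prop := ∀ k, |c k| ≤ ((2 * k)! : ℝ)⁻¹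

/-- coefficients of `sinh t / t`. -/
def shcC (k : ℕ) : ℝ := ((2 * k + 1)! : ℝ)⁻¹

/-- coefficients of `cosh t`. -/
def chcC (k : ℕ) : ℝ := ((2 * k)! : ℝ)⁻¹

/-- The even series `∑ c k T^(2k)`. -/
def evs (c : ℕ → ℝ) (T : 𝔸) : 𝔸 := ∑' k, c k • T ^ (2 * k)

theorem shcC_ok : CoefOK shcC := by
  intro k
  unfold shcC
  rw [abs_of_nonneg (by positivity)]
  apply inv_anti₀ (by positivity)
  exact_mod_cast Nat.factorial_le (by omega)

theorem chcC_ok : CoefOK chcC := by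
  intro k
  unfold chcC
  rw [abs_of_nonneg (by positivity)]

theorem norm_pow_le_of (h1 : ‖(1 : 𝔸)‖ ≤ 1) (T : 𝔸) (n : ℕ) : ‖T ^ n‖ ≤ ‖T‖ ^ n := by
  rcases Nat.eq_zero_or_pos n with rfl | hn
  · simpa using h1
  · exact norm_pow_le' T hn

theorem even_real_summable (r : ℝ) : Summable fun k : ℕ => ((2 * k)! : ℝ)⁻¹ * r ^ (2 * k) := by
  have h := (Real.summable_pow_div_factorial r).comp_injective
    (i := fun k : ℕ => 2 * k) (fun a b h => by simpa using h)
  refine h.congr fun k => ?_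
  simp [div_eq_mul_inv, mul_comm]

theorem even_real_tsum_le {r : ℝ} (hr : 0 ≤ r) :
    ∑' k : ℕ, ((2 * k)! : ℝ)⁻¹ * r ^ (2 * k) ≤ Real.exp r := by
  have h := (Real.summable_pow_div_factorial r)
  rw [Real.exp_eq_exp_ℝ, NormedSpace.exp_eq_tsum_div]
  have := tsum_comp_le_tsum_of_inj h (fun n => by positivity)
    (i := fun k : ℕ => 2 * k) (fun a b h => by simpa using h)
  refine le_trans (le_of_eq ?_) this
  apply tsum_congr
  intro k; simp [div_eq_mul_inv, mul_comm]

theorem evs_term_le {c : ℕ → ℝ} (hc : CoefOK c) (h1 : ‖(1 : 𝔸)‖ ≤ 1) (T : 𝔸) (k : ℕ) :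
    ‖c k • T ^ (2 * k)‖ ≤ ((2 * k)! : ℝ)⁻¹ * ‖T‖ ^ (2 * k) := by
  rw [norm_smul, Real.norm_eq_abs]
  exact mul_le_mul (hc k) (norm_pow_le_of h1 _ _) (norm_nonneg _) (by positivity)

theorem evs_summable {c : ℕ → ℝ} (hc : CoefOK c) (h1 : ‖(1 : 𝔸)‖ ≤ 1) (T : 𝔸) :
    Summable fun k => c k • T ^ (2 * k) :=
  Summable.of_norm_bounded (even_real_summable ‖T‖) (evs_term_le hc h1 T)

theorem evs_hasSum {c : ℕ → ℝ} (hc : CoefOK c) (h1 : ‖(1 : 𝔸)‖ ≤ 1) (T : 𝔸) :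
    HasSum (fun k => c k • T ^ (2 * k)) (evs c T) := (evs_summable hc h1 T).hasSum

theorem evs_norm_le {c : ℕ → ℝ} (hc : CoefOK c) (h1 : ‖(1 : 𝔸)‖ ≤ 1) (T : 𝔸) :
    ‖evs c T‖ ≤ Real.exp ‖T‖ :=
  (tsum_of_norm_bounded (even_real_summable ‖T‖).hasSum (evs_term_le hc h1 T)).trans
    (even_real_tsum_le (norm_nonneg _))

theorem norm_pow_sub_pow_le (h1 : ‖(1 : 𝔸)‖ ≤ 1) {S T : 𝔸} {R : ℝ} (hS : ‖S‖ ≤ R)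
    (hT : ‖T‖ ≤ R) (n : ℕ) : ‖T ^ n - S ^ n‖ ≤ n * R ^ (n - 1) * ‖T - S‖ := by
  have hR : 0 ≤ R := (norm_nonneg _).trans hS
  induction n with
  | zero => simp
  | succ n ih =>
    have : T ^ (n + 1) - S ^ (n + 1) = T ^ n * (T - S) + (T ^ n - S ^ n) * S := by
      rw [pow_succ, pow_succ]; noncomm_ring
    rw [this]
    have a1 : ‖T ^ n * (T - S)‖ ≤ R ^ n * ‖T - S‖ := by
      refine (norm_mul_le _ _).trans ?_
      gcongr
      exact (norm_pow_le_of h1 _ _).trans (by gcongr)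
    have a2 : ‖(T ^ n - S ^ n) * S‖ ≤ n * R ^ n * ‖T - S‖ := by
      refine (norm_mul_le _ _).trans ?_
      refine (mul_le_mul ih hS (norm_nonneg _) (by positivity)).trans (le_of_eq ?_)
      rcases n with _ | n
      · simp
      · simp only [Nat.add_sub_cancel]; ring
    refine (norm_add_le _ _).trans ((add_le_add a1 a2).trans (le_of_eq ?_))
    push_cast
    ring

theorem even_deriv_bound {r : ℝ} (hr : 0 ≤ r) (k : ℕ) :
    ((2 * k)! : ℝ)⁻¹ * (((2 * k : ℕ) : ℝ) * r ^ (2 * k - 1)) ≤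
      ((2 * k)! : ℝ)⁻¹ * (2 * (r + 1)) ^ (2 * k) := by
  gcongr
  rw [mul_pow]
  have h2 : ((2 * k : ℕ) : ℝ) ≤ 2 ^ (2 * k) := by exact_mod_cast Nat.lt_two_pow_self.le
  have h3 : r ^ (2 * k - 1) ≤ (r + 1) ^ (2 * k) :=
    (pow_le_pow_left₀ hr (by linarith) _).trans (pow_le_pow_right₀ (by linarith) (by omega))
  exact mul_le_mul h2 h3 (by positivity) (by positivity)

theorem evs_lipschitz {c : ℕ → ℝ} (hc : CoefOK c) (h1 : ‖(1 : 𝔸)‖ ≤ 1) {S T : 𝔸} {R : ℝ}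
    (hS : ‖S‖ ≤ R) (hT : ‖T‖ ≤ R) :
    ‖evs c T - evs c S‖ ≤ Real.exp (2 * (R + 1)) * ‖T - S‖ := by
  have hR : 0 ≤ R := (norm_nonneg _).trans hS
  have hs : HasSum (fun k => c k • T ^ (2 * k) - c k • S ^ (2 * k)) (evs c T - evs c S) :=
    (evs_hasSum hc h1 T).sub (evs_hasSum hc h1 S)
  have hb := ((even_real_summable (2 * (R + 1))).hasSum.mul_right ‖T - S‖)
  rw [← hs.tsum_eq]
  refine (tsum_of_norm_bounded hb fun k => ?_).trans ?_
  · rw [← smul_sub, norm_smul, Real.norm_eq_abs]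
    calc |c k| * ‖T ^ (2 * k) - S ^ (2 * k)‖
        ≤ ((2 * k)! : ℝ)⁻¹ * (((2 * k : ℕ) : ℝ) * R ^ (2 * k - 1) * ‖T - S‖) :=
          mul_le_mul (hc k) (norm_pow_sub_pow_le h1 hS hT _) (norm_nonneg _) (by positivity)
      _ = ((2 * k)! : ℝ)⁻¹ * (((2 * k : ℕ) : ℝ) * R ^ (2 * k - 1)) * ‖T - S‖ := by ring
      _ ≤ _ := by
          exact mul_le_mul_of_nonneg_right (even_deriv_bound hR k) (norm_nonneg _)
  · gcongr
    exact even_real_tsum_le (by positivity)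

theorem two_mul_shc (h1 : ‖(1 : 𝔸)‖ ≤ 1) (T : 𝔸) :
    (2 : ℝ) • (evs shcC T * T) = NormedSpace.exp T - NormedSpace.exp (-T) := by
  have hs := (NormedSpace.exp_series_hasSum_exp' (𝕂 := ℝ) T).sub
    (NormedSpace.exp_series_hasSum_exp' (𝕂 := ℝ) (-T))
  have hi : Function.Injective (fun k : ℕ => 2 * k + 1) := fun a b h => by simpa using h
  rw [← hi.hasSum_iff] at hs
  · refine HasSum.unique ?_ hs
    have h2 := ((evs_hasSum shcC_ok h1 T).mul_right T).const_smul (2 : ℝ)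
    refine Eq.mp (congrArg (fun f => HasSum f _) ?_) h2
    funext k
    symm
    change ((2 * k + 1)! : ℝ)⁻¹ • T ^ (2 * k + 1) - ((2 * k + 1)! : ℝ)⁻¹ • (-T) ^ (2 * k + 1) =
      (2 : ℝ) • ((((2 * k + 1)! : ℝ)⁻¹ • T ^ (2 * k)) * T)
    rw [Odd.neg_pow ⟨k, rfl⟩, smul_mul_assoc, ← pow_succ, smul_neg, sub_neg_eq_add, two_smul]
  · intro n hn
    have : Even n := by
      by_contra h
      obtain ⟨k, rfl⟩ := Nat.not_even_iff_odd.1 h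
      exact hn ⟨k, rfl⟩
    rw [this.neg_pow, sub_self]

theorem two_chc (h1 : ‖(1 : 𝔸)‖ ≤ 1) (T : 𝔸) :
    (2 : ℝ) • (evs chcC T) = NormedSpace.exp T + NormedSpace.exp (-T) := by
  have hs := (NormedSpace.exp_series_hasSum_exp' (𝕂 := ℝ) T).add
    (NormedSpace.exp_series_hasSum_exp' (𝕂 := ℝ) (-T))
  have hi : Function.Injective (fun k : ℕ => 2 * k) := fun a b h => by simpa using h
  rw [← hi.hasSum_iff] at hs
  · refine HasSum.unique ?_ hs
    have h2 := ((evs_hasSum chcC_ok h1 T)).const_smul (2 : ℝ)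
    convert h2 using 2 with k
    simp only [Function.comp, chcC]
    rw [Even.neg_pow ⟨k, by ring⟩, two_smul]
  · intro n hn
    have : Odd n := by
      by_contra h
      obtain ⟨k, rfl⟩ := Nat.not_odd_iff_even.1 h
      exact hn ⟨k, by ring⟩
    rw [this.neg_pow, smul_neg, add_neg_cancel]

theorem evs_shc_zero : evs shcC (0 : 𝔸) = 1 := by
  unfold evs
  rw [tsum_eq_single 0]
  · simp [shcC]
  · intro k hk
    rw [zero_pow (by omega), smul_zero]

theorem rexp_norm_le (h1 : ‖(1 : 𝔸)‖ ≤ 1) (x : 𝔸) : ‖NormedSpace.exp x‖ ≤ Real.exp ‖x‖ := by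
  have h := NormedSpace.exp_series_hasSum_exp' (𝕂 := ℝ) x
  rw [← h.tsum_eq]
  have h2 := NormedSpace.exp_series_hasSum_exp' (𝕂 := ℝ) ‖x‖
  rw [← Real.exp_eq_exp_ℝ] at h2
  refine tsum_of_norm_bounded h2 fun n => ?_
  rw [norm_smul, smul_eq_mul, norm_inv, Real.norm_natCast]
  gcongr
  exact norm_pow_le_of h1 _ _

end EvenSeries


/-! ### Hilbert–Schmidt operators as a real Hilbert space -/

section HSBasics

set_option linter.unusedSectionVars false

open scoped ENNReal
open Filter Topology

/-- The squared Hilbert–Schmidt norm as an extended real. -/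
def hs2 (e : HilbertBasis ι ℂ H) (A : H →L[ℂ] H) : ℝ≥0∞ :=
  ∑' i, ENNReal.ofReal (‖A (e i)‖ ^ 2)

theorem isHS_iff (e : HilbertBasis ι ℂ H) (A : H →L[ℂ] H) : IsHS e A ↔ hs2 e A ≠ ⊤ := by
  constructor
  · intro h
    unfold hs2
    rw [← ENNReal.ofReal_tsum_of_nonneg (fun i => by positivity) h]
    exact ENNReal.ofReal_ne_top
  · intro h
    have := ENNReal.summable_toReal h
    refine this.congr fun i => ?_
    rw [ENNReal.toReal_ofReal (by positivity)]

theorem hsNorm_nonneg (e : HilbertBasis ι ℂ H) (A : H →L[ℂ] H) : 0 ≤ hsNorm e A :=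
  Real.sqrt_nonneg _

theorem hsNorm_sq (e : HilbertBasis ι ℂ H) (A : H →L[ℂ] H) :
    hsNorm e A ^ 2 = ∑' i, ‖A (e i)‖ ^ 2 :=
  Real.sq_sqrt (tsum_nonneg fun i => by positivity)

theorem hs2_eq (e : HilbertBasis ι ℂ H) {A : H →L[ℂ] H} (h : IsHS e A) :
    hs2 e A = ENNReal.ofReal (hsNorm e A ^ 2) := by
  rw [hsNorm_sq, ENNReal.ofReal_tsum_of_nonneg (fun i => by positivity) h]
  rfl

theorem hs2_le_imp (e : HilbertBasis ι ℂ H) {A : H →L[ℂ] H} {c : ℝ} (hc : 0 ≤ c)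
    (h : hs2 e A ≤ ENNReal.ofReal (c ^ 2)) : IsHS e A ∧ hsNorm e A ≤ c := by
  have h1 : IsHS e A := (isHS_iff e A).2 (ne_top_of_le_ne_top ENNReal.ofReal_ne_top h)
  refine ⟨h1, ?_⟩
  rw [hs2_eq e h1, ENNReal.ofReal_le_ofReal_iff (by positivity)] at h
  exact (sq_le_sq₀ (hsNorm_nonneg e A) hc).1 h

theorem parseval_ennreal (e : HilbertBasis ι ℂ H) (x : H) :
    ∑' i, ENNReal.ofReal (‖inner ℂ (e i) x‖ ^ 2) = ENNReal.ofReal (‖x‖ ^ 2) := by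
  have h := e.hasSum_inner_mul_inner x x
  have h2 : HasSum (fun i => ‖inner ℂ (e i) x‖ ^ 2) (‖x‖ ^ 2) := by
    have h3 := Complex.hasSum_re h
    have : (inner ℂ x x : ℂ).re = ‖x‖ ^ 2 := by
      simpa using inner_self_eq_norm_sq (𝕜 := ℂ) x
    rw [this] at h3
    refine Eq.mp (congrArg (fun f => HasSum f _) ?_) h3
    funext i
    rw [← inner_conj_symm x (e i), mul_comm, Complex.mul_conj, Complex.normSq_eq_norm_sq]
    exact Complex.ofReal_re _
  rw [← ENNReal.ofReal_tsum_of_nonneg (fun i => by positivity) h2.summable, h2.tsum_eq]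

theorem hs2_star (e : HilbertBasis ι ℂ H) (A : H →L[ℂ] H) : hs2 e (star A) = hs2 e A := by
  unfold hs2
  calc ∑' i, ENNReal.ofReal (‖(star A) (e i)‖ ^ 2)
      = ∑' i, ∑' j, ENNReal.ofReal (‖inner ℂ (e j) ((star A) (e i))‖ ^ 2) := by
        simp_rw [parseval_ennreal e]
    _ = ∑' j, ∑' i, ENNReal.ofReal (‖inner ℂ (e j) ((star A) (e i))‖ ^ 2) := ENNReal.tsum_comm
    _ = ∑' j, ∑' i, ENNReal.ofReal (‖inner ℂ (e i) (A (e j))‖ ^ 2) := by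
        refine tsum_congr fun j => tsum_congr fun i => ?_
        rw [ContinuousLinearMap.star_eq_adjoint, ContinuousLinearMap.adjoint_inner_right,
          norm_inner_symm]
    _ = _ := by simp_rw [parseval_ennreal e]

theorem hs2_mul_le (e : HilbertBasis ι ℂ H) (B A : H →L[ℂ] H) :
    hs2 e (B * A) ≤ ENNReal.ofReal (‖B‖ ^ 2) * hs2 e A := by
  unfold hs2
  rw [← ENNReal.tsum_mul_left]
  refine ENNReal.tsum_le_tsum fun i => ?_
  rw [← ENNReal.ofReal_mul (by positivity), ← mul_pow]
  apply ENNReal.ofReal_le_ofReal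
  gcongr
  exact B.le_opNorm _

theorem hs2_mul_le' (e : HilbertBasis ι ℂ H) (A B : H →L[ℂ] H) :
    hs2 e (A * B) ≤ ENNReal.ofReal (‖B‖ ^ 2) * hs2 e A := by
  rw [← hs2_star, star_mul]
  refine (hs2_mul_le e _ _).trans ?_
  rw [hs2_star, norm_star]

theorem norm_sq_le_hs2 (e : HilbertBasis ι ℂ H) (A : H →L[ℂ] H) :
    ENNReal.ofReal (‖A‖ ^ 2) ≤ hs2 e A := by
  by_cases h : IsHS e A
  swap
  · have : hs2 e A = ⊤ := by
      by_contra h'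
      exact h ((isHS_iff e A).2 h')
    rw [this]; exact le_top
  rw [hs2_eq e h]
  apply ENNReal.ofReal_le_ofReal
  gcongr
  refine A.opNorm_le_bound (hsNorm_nonneg e A) fun x => ?_
  have key : ENNReal.ofReal (‖A x‖ ^ 2) ≤ ENNReal.ofReal ((hsNorm e A * ‖x‖) ^ 2) := by
    rw [mul_pow, ENNReal.ofReal_mul (by positivity), ← hs2_eq e h, ← hs2_star,
      ← parseval_ennreal e, hs2, ← ENNReal.tsum_mul_right]
    refine ENNReal.tsum_le_tsum fun i => ?_
    rw [← ENNReal.ofReal_mul (by positivity), ← mul_pow]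
    apply ENNReal.ofReal_le_ofReal
    gcongr
    rw [← ContinuousLinearMap.adjoint_inner_left, ContinuousLinearMap.star_eq_adjoint]
    exact norm_inner_le_norm _ _
  rw [ENNReal.ofReal_le_ofReal_iff (by positivity)] at key
  exact (sq_le_sq₀ (norm_nonneg _) (mul_nonneg (hsNorm_nonneg e A) (norm_nonneg _))).1 key

theorem norm_le_hsNorm (e : HilbertBasis ι ℂ H) {A : H →L[ℂ] H} (h : IsHS e A) :
    ‖A‖ ≤ hsNorm e A := by
  have := norm_sq_le_hs2 e A
  rw [hs2_eq e h, ENNReal.ofReal_le_ofReal_iff (by positivity)] at this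
  exact (sq_le_sq₀ (norm_nonneg _) (hsNorm_nonneg e A)).1 this

theorem IsHS.mul_left {e : HilbertBasis ι ℂ H} {A : H →L[ℂ] H} (B : H →L[ℂ] H) (h : IsHS e A) :
    IsHS e (B * A) ∧ hsNorm e (B * A) ≤ ‖B‖ * hsNorm e A := by
  apply hs2_le_imp e (mul_nonneg (norm_nonneg _) (hsNorm_nonneg e A))
  refine (hs2_mul_le e B A).trans ?_
  rw [hs2_eq e h, mul_pow, ENNReal.ofReal_mul (by positivity)]

theorem IsHS.mul_right {e : HilbertBasis ι ℂ H} {A : H →L[ℂ] H} (B : H →L[ℂ] H) (h : IsHS e A) :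
    IsHS e (A * B) ∧ hsNorm e (A * B) ≤ hsNorm e A * ‖B‖ := by
  apply hs2_le_imp e (mul_nonneg (hsNorm_nonneg e A) (norm_nonneg _))
  refine (hs2_mul_le' e A B).trans ?_
  rw [hs2_eq e h, mul_pow, ENNReal.ofReal_mul (by positivity), mul_comm]

theorem IsHS.star {e : HilbertBasis ι ℂ H} {A : H →L[ℂ] H} (h : IsHS e A) :
    IsHS e (star A) := by
  rw [isHS_iff, hs2_star, ← isHS_iff]; exact h

theorem IsHS.add {e : HilbertBasis ι ℂ H} {A B : H →L[ℂ] H} (hA : IsHS e A) (hB : IsHS e B) :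
    IsHS e (A + B) := by
  refine Summable.of_nonneg_of_le (fun i => by positivity) (fun i => ?_)
    ((Summable.mul_left 2 hA).add (Summable.mul_left 2 hB))
  have h1 : ‖(A + B) (e i)‖ ≤ ‖A (e i)‖ + ‖B (e i)‖ := norm_add_le _ _
  have h2 := norm_nonneg ((A + B) (e i))
  nlinarith [sq_nonneg (‖A (e i)‖ - ‖B (e i)‖)]

theorem IsHS.smul {e : HilbertBasis ι ℂ H} {A : H →L[ℂ] H} (r : ℝ) (hA : IsHS e A) :
    IsHS e (r • A) := by
  refine (Summable.mul_left (r ^ 2) hA).congr fun i => ?_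
  rw [smul_apply, norm_smul, mul_pow]
  simp

theorem IsHS.zero (e : HilbertBasis ι ℂ H) : IsHS e (0 : H →L[ℂ] H) := by
  unfold IsHS; simpa using summable_zero

theorem IsHS.neg {e : HilbertBasis ι ℂ H} {A : H →L[ℂ] H} (hA : IsHS e A) : IsHS e (-A) := by
  simpa using hA.smul (-1)

theorem IsHS.sub {e : HilbertBasis ι ℂ H} {A B : H →L[ℂ] H} (hA : IsHS e A) (hB : IsHS e B) :
    IsHS e (A - B) := by
  rw [sub_eq_add_neg]; exact hA.add hB.neg

/-- Lower semicontinuity of the Hilbert–Schmidt norm. -/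
theorem hs_fatou (e : HilbertBasis ι ℂ H) {A : H →L[ℂ] H} {B : ℕ → H →L[ℂ] H} {c : ℝ}
    (hc : 0 ≤ c) (hB : Tendsto B atTop (𝓝 A)) (hHS : ∀ᶠ n in atTop, IsHS e (B n))
    (hle : ∀ᶠ n in atTop, hsNorm e (B n) ≤ c) : IsHS e A ∧ hsNorm e A ≤ c := by
  apply hs2_le_imp e hc
  unfold hs2
  rw [ENNReal.tsum_eq_iSup_sum]
  refine iSup_le fun s => ?_
  rw [← ENNReal.ofReal_sum_of_nonneg (fun i _ => by positivity)]
  apply ENNReal.ofReal_le_ofReal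
  have ht : Tendsto (fun n => ∑ i ∈ s, ‖B n (e i)‖ ^ 2) atTop (𝓝 (∑ i ∈ s, ‖A (e i)‖ ^ 2)) := by
    refine tendsto_finsetSum _ fun i _ => ?_
    have : Tendsto (fun n => B n (e i)) atTop (𝓝 (A (e i))) :=
      ((ContinuousLinearMap.apply ℂ H (e i)).continuous.tendsto A).comp hB
    exact (this.norm).pow 2
  refine le_of_tendsto ht ?_
  filter_upwards [hHS, hle] with n h1 h2
  calc ∑ i ∈ s, ‖B n (e i)‖ ^ 2 ≤ ∑' i, ‖B n (e i)‖ ^ 2 :=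
        Summable.sum_le_tsum s (fun i _ => by positivity) h1
    _ = hsNorm e (B n) ^ 2 := (hsNorm_sq e _).symm
    _ ≤ c ^ 2 := by
        have := hsNorm_nonneg e (B n)
        gcongr

/-- The real vector space of Hilbert–Schmidt operators. -/
def HSsub (e : HilbertBasis ι ℂ H) : Submodule ℝ (H →L[ℂ] H) where
  carrier := {A | IsHS e A}
  add_mem' := fun h1 h2 => IsHS.add h1 h2
  zero_mem' := IsHS.zero e
  smul_mem' := fun r _ h => IsHS.smul r h

/-- The Hilbert–Schmidt operators as a type of their own (to carry the HS norm). -/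
def HSO (e : HilbertBasis ι ℂ H) : Type _ := HSsub e

/-- Additive structure (used only to set up the normed structure). -/
@[reducible] def HSO.acg (e : HilbertBasis ι ℂ H) : AddCommGroup (HSO e) :=
  inferInstanceAs (AddCommGroup (HSsub e))

/-- Module structure (used only to set up the normed structure). -/
@[reducible] def HSO.mod (e : HilbertBasis ι ℂ H) : @Module ℝ (HSO e) _ (HSO.acg e).toAddCommMonoid :=
  inferInstanceAs (Module ℝ (HSsub e))

/-- The underlying operator. -/
def HSO.op {e : HilbertBasis ι ℂ H} (A : HSO e) : H →L[ℂ] H := Subtype.val A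

/-- Bundle an operator. -/
def HSO.mk {e : HilbertBasis ι ℂ H} (A : H →L[ℂ] H) (h : IsHS e A) : HSO e := ⟨A, h⟩

theorem HSO.hs {e : HilbertBasis ι ℂ H} (A : HSO e) : IsHS e A.op := Subtype.property A

@[simp] theorem HSO.op_mk {e : HilbertBasis ι ℂ H} (A : H →L[ℂ] H) (h : IsHS e A) :
    (HSO.mk A h).op = A := rfl
theorem HSO.ext {e : HilbertBasis ι ℂ H} {A B : HSO e} (h : A.op = B.op) : A = B :=
  Subtype.ext h

theorem hs_inner_summable {e : HilbertBasis ι ℂ H} {A B : H →L[ℂ] H} (hA : IsHS e A)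
    (hB : IsHS e B) : Summable fun i => (inner ℂ (A (e i)) (B (e i)) : ℂ) := by
  refine Summable.of_norm_bounded (Summable.add hA hB) fun i => ?_
  refine (norm_inner_le_norm _ _).trans ?_
  nlinarith [sq_nonneg (‖A (e i)‖ - ‖B (e i)‖), sq_nonneg (‖A (e i)‖), sq_nonneg (‖B (e i)‖)]

theorem hsInner_self {e : HilbertBasis ι ℂ H} {A : H →L[ℂ] H} (hA : IsHS e A) :
    hsInner e A A = hsNorm e A ^ 2 := by
  rw [hsNorm_sq, hsInner, Complex.re_tsum (hs_inner_summable hA hA)]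
  refine tsum_congr fun i => ?_
  simpa using inner_self_eq_norm_sq (𝕜 := ℂ) (A (e i))

theorem hsInner_smul_left {e : HilbertBasis ι ℂ H} {A B : H →L[ℂ] H} (hA : IsHS e A)
    (hB : IsHS e B) (r : ℝ) : hsInner e (r • A) B = r * hsInner e A B := by
  unfold hsInner
  rw [Complex.re_tsum (hs_inner_summable (hA.smul r) hB), Complex.re_tsum (hs_inner_summable hA hB),
    ← tsum_mul_left]
  refine tsum_congr fun i => ?_
  have h : (r • A) (e i) = (r : ℂ) • A (e i) := rfl
  rw [h, inner_smul_left, Complex.conj_ofReal, Complex.re_ofReal_mul]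

section core
attribute [local instance] HSO.acg HSO.mod

/-- The HS inner product. -/
@[reducible]
def hsCore (e : HilbertBasis ι ℂ H) : InnerProductSpace.Core ℝ (HSO e) where
  inner A B := hsInner e A.op B.op
  conj_inner_symm A B := by
    simp only [conj_trivial, hsInner]
    rw [Complex.re_tsum (hs_inner_summable A.hs B.hs), Complex.re_tsum (hs_inner_summable B.hs A.hs)]
    refine tsum_congr fun i => ?_
    rw [← inner_conj_symm, Complex.conj_re]
  re_inner_nonneg A := by
    simp only [RCLike.re_to_real]
    rw [hsInner_self A.hs]; positivity
  add_left A B C := by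
    change hsInner e (A.op + B.op) C.op = _
    simp only [hsInner, add_apply, inner_add_left]
    rw [Summable.tsum_add (hs_inner_summable A.hs C.hs) (hs_inner_summable B.hs C.hs), Complex.add_re]
  smul_left A B r := hsInner_smul_left A.hs B.hs r
  definite A h := by
    rw [hsInner_self A.hs] at h
    have h2 := norm_le_hsNorm e A.hs
    have h3 : hsNorm e A.op = 0 := by simpa using h
    rw [h3] at h2
    exact HSO.ext (show A.op = 0 by simpa using h2)

instance (e : HilbertBasis ι ℂ H) : NormedAddCommGroup (HSO e) :=
  @InnerProductSpace.Core.toNormedAddCommGroup ℝ (HSO e) _ _ _ (hsCore e)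

instance (e : HilbertBasis ι ℂ H) : InnerProductSpace ℝ (HSO e) :=
  InnerProductSpace.ofCore (hsCore e).toCore

end core

@[simp] theorem HSO.op_add {e : HilbertBasis ι ℂ H} (A B : HSO e) :
    (A + B).op = A.op + B.op := rfl
@[simp] theorem HSO.op_sub {e : HilbertBasis ι ℂ H} (A B : HSO e) :
    (A - B).op = A.op - B.op := rfl
@[simp] theorem HSO.op_neg {e : HilbertBasis ι ℂ H} (A : HSO e) : (-A).op = -A.op := rfl
@[simp] theorem HSO.op_zero {e : HilbertBasis ι ℂ H} : (0 : HSO e).op = 0 := rfl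
@[simp] theorem HSO.op_smul {e : HilbertBasis ι ℂ H} (r : ℝ) (A : HSO e) :
    (r • A).op = r • A.op := rfl

theorem HSO.inner_def {e : HilbertBasis ι ℂ H} (A B : HSO e) :
    inner ℝ A B = hsInner e A.op B.op := rfl

theorem HSO.norm_def {e : HilbertBasis ι ℂ H} (A : HSO e) : ‖A‖ = hsNorm e A.op := by
  have h : ‖A‖ ^ 2 = hsNorm e A.op ^ 2 := by
    rw [← real_inner_self_eq_norm_sq, HSO.inner_def, hsInner_self A.hs]
  exact (sq_eq_sq₀ (norm_nonneg _) (hsNorm_nonneg _ _)).1 h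

theorem HSO.op_norm_le {e : HilbertBasis ι ℂ H} (A : HSO e) : ‖A.op‖ ≤ ‖A‖ := by
  rw [HSO.norm_def]; exact norm_le_hsNorm e A.hs

/-- Inclusion of HS operators into bounded operators. -/
def HSO.incl (e : HilbertBasis ι ℂ H) : HSO e →L[ℝ] (H →L[ℂ] H) :=
  LinearMap.mkContinuous
    { toFun := HSO.op, map_add' := fun _ _ => rfl, map_smul' := fun _ _ => rfl } 1
    (fun A => by rw [one_mul]; exact HSO.op_norm_le A)

@[simp] theorem HSO.incl_apply {e : HilbertBasis ι ℂ H} (A : HSO e) : HSO.incl e A = A.op := rfl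

theorem hs_cauchy_limit (e : HilbertBasis ι ℂ H) {A : ℕ → H →L[ℂ] H} (hA : ∀ n, IsHS e (A n))
    (hc : ∀ ε > 0, ∃ N, ∀ m ≥ N, ∀ n ≥ N, hsNorm e (A m - A n) < ε) :
    ∃ B, IsHS e B ∧ Tendsto A atTop (𝓝 B) ∧
      ∀ ε > 0, ∃ N, ∀ n ≥ N, hsNorm e (B - A n) ≤ ε := by
  have hC : CauchySeq A := by
    rw [Metric.cauchySeq_iff]
    intro ε hε
    obtain ⟨N, hN⟩ := hc ε hε
    refine ⟨N, fun m hm n hn => ?_⟩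
    rw [dist_eq_norm]
    exact (norm_le_hsNorm e ((hA m).sub (hA n))).trans_lt (hN m hm n hn)
  obtain ⟨B, hB⟩ := cauchySeq_tendsto_of_complete hC
  have key : ∀ ε > 0, ∃ N, ∀ n ≥ N, IsHS e (B - A n) ∧ hsNorm e (B - A n) ≤ ε := by
    intro ε hε
    obtain ⟨N, hN⟩ := hc ε hε
    refine ⟨N, fun n hn => ?_⟩
    refine hs_fatou e hε.le (hB.sub_const (A n)) ?_ ?_
    · exact Eventually.of_forall fun m => (hA m).sub (hA n)
    · filter_upwards [eventually_ge_atTop N] with m hm using (hN m hm n hn).le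
  refine ⟨B, ?_, hB, fun ε hε => ?_⟩
  · obtain ⟨N, hN⟩ := key 1 one_pos
    have := (hN N le_rfl).1.add (hA N)
    simpa using this
  · obtain ⟨N, hN⟩ := key ε hε
    exact ⟨N, fun n hn => (hN n hn).2⟩

instance (e : HilbertBasis ι ℂ H) : CompleteSpace (HSO e) := by
  apply Metric.complete_of_cauchySeq_tendsto
  intro A hA
  obtain ⟨B, hB, -, h⟩ := hs_cauchy_limit e (A := fun n => (A n).op) (fun n => (A n).hs) (by
    intro ε hε
    obtain ⟨N, hN⟩ := Metric.cauchySeq_iff.1 hA ε hε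
    refine ⟨N, fun m hm n hn => ?_⟩
    have := hN m hm n hn
    rwa [dist_eq_norm, HSO.norm_def] at this)
  refine ⟨HSO.mk B hB, ?_⟩
  rw [Metric.tendsto_atTop]
  intro ε hε
  obtain ⟨N, hN⟩ := h (ε / 2) (by positivity)
  refine ⟨N, fun n hn => ?_⟩
  rw [dist_comm, dist_eq_norm, HSO.norm_def]
  have := hN n hn
  simp only [HSO.op_sub, HSO.op_mk]
  linarith

theorem hsNorm_add_le {e : HilbertBasis ι ℂ H} {A B : H →L[ℂ] H} (hA : IsHS e A) (hB : IsHS e B) :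
    hsNorm e (A + B) ≤ hsNorm e A + hsNorm e B := by
  have := norm_add_le (HSO.mk A hA) (HSO.mk B hB)
  simpa [HSO.norm_def] using this

theorem hsNorm_smul {e : HilbertBasis ι ℂ H} {A : H →L[ℂ] H} (r : ℝ) (hA : IsHS e A) :
    hsNorm e (r • A) = |r| * hsNorm e A := by
  have := norm_smul r (HSO.mk A hA)
  simpa [HSO.norm_def] using this

theorem hsNorm_neg {e : HilbertBasis ι ℂ H} (A : H →L[ℂ] H) :
    hsNorm e (-A) = hsNorm e A := by
  simp [hsNorm]

theorem hsNorm_sub_rev {e : HilbertBasis ι ℂ H} (A B : H →L[ℂ] H) :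
    hsNorm e (A - B) = hsNorm e (B - A) := by
  rw [← hsNorm_neg, neg_sub]

theorem hsNorm_parallelogram {e : HilbertBasis ι ℂ H} {A B : H →L[ℂ] H} (hA : IsHS e A)
    (hB : IsHS e B) :
    hsNorm e (A + B) ^ 2 + hsNorm e (A - B) ^ 2 = 2 * (hsNorm e A ^ 2 + hsNorm e B ^ 2) := by
  have := parallelogram_law_with_norm ℝ (HSO.mk A hA) (HSO.mk B hB)
  simp only [HSO.norm_def, HSO.op_add, HSO.op_sub, HSO.op_mk] at this
  linarith

theorem hsNorm_eq_zero {e : HilbertBasis ι ℂ H} {A : H →L[ℂ] H} (hA : IsHS e A)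
    (h : hsNorm e A = 0) : A = 0 := by
  have := norm_le_hsNorm e hA
  rw [h] at this
  simpa using this

end HSBasics


/-! ### Superoperators -/

section Super

set_option linter.unusedSectionVars false
open Filter Topology
open scoped Nat

/-- Left multiplication on bounded operators. -/
def lmB (a : H →L[ℂ] H) : (H →L[ℂ] H) →L[ℝ] (H →L[ℂ] H) :=
  LinearMap.mkContinuous
    { toFun := fun M => a * M, map_add' := fun _ _ => mul_add _ _ _,
      map_smul' := fun r M => mul_smul_comm r a M } ‖a‖ (fun M => norm_mul_le a M)

/-- Right multiplication on bounded operators. -/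
def rmB (b : H →L[ℂ] H) : (H →L[ℂ] H) →L[ℝ] (H →L[ℂ] H) :=
  LinearMap.mkContinuous
    { toFun := fun M => M * b, map_add' := fun _ _ => add_mul _ _ _,
      map_smul' := fun r M => smul_mul_assoc r M b } ‖b‖
      (fun M => by rw [mul_comm]; exact norm_mul_le M b)

theorem lmB_apply (a M : H →L[ℂ] H) : lmB a M = a * M := rfl
theorem rmB_apply (a M : H →L[ℂ] H) : rmB a M = M * a := rfl

/-- Left multiplication on HS operators. -/
def lmH (e : HilbertBasis ι ℂ H) (a : H →L[ℂ] H) : HSO e →L[ℝ] HSO e :=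
  LinearMap.mkContinuous
    { toFun := fun M => HSO.mk (a * M.op) (M.hs.mul_left a).1,
      map_add' := fun _ _ => HSO.ext (mul_add _ _ _),
      map_smul' := fun r M => HSO.ext (mul_smul_comm r a M.op) } ‖a‖ (fun M => by
        rw [HSO.norm_def, HSO.norm_def]; exact (M.hs.mul_left a).2)

/-- Right multiplication on HS operators. -/
def rmH (e : HilbertBasis ι ℂ H) (b : H →L[ℂ] H) : HSO e →L[ℝ] HSO e :=
  LinearMap.mkContinuous
    { toFun := fun M => HSO.mk (M.op * b) (M.hs.mul_right b).1,
      map_add' := fun _ _ => HSO.ext (add_mul _ _ _),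
      map_smul' := fun r M => HSO.ext (smul_mul_assoc r M.op b) } ‖b‖ (fun M => by
        rw [HSO.norm_def, HSO.norm_def, mul_comm]; exact (M.hs.mul_right b).2)

@[simp] theorem lmH_op (e : HilbertBasis ι ℂ H) (a : H →L[ℂ] H) (M : HSO e) :
    (lmH e a M).op = a * M.op := rfl
@[simp] theorem rmH_op (e : HilbertBasis ι ℂ H) (a : H →L[ℂ] H) (M : HSO e) :
    (rmH e a M).op = M.op * a := rfl

theorem lmH_norm (e : HilbertBasis ι ℂ H) (a : H →L[ℂ] H) : ‖lmH e a‖ ≤ ‖a‖ :=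
  LinearMap.mkContinuous_norm_le _ (norm_nonneg _) _
theorem rmH_norm (e : HilbertBasis ι ℂ H) (a : H →L[ℂ] H) : ‖rmH e a‖ ≤ ‖a‖ :=
  LinearMap.mkContinuous_norm_le _ (norm_nonneg _) _

section gen
variable {V W : Type*} [NormedAddCommGroup V] [NormedSpace ℝ V] [CompleteSpace V]
  [NormedAddCommGroup W] [NormedSpace ℝ W] [CompleteSpace W]

theorem clm_one_le : ‖(1 : V →L[ℝ] V)‖ ≤ 1 := ContinuousLinearMap.norm_id_le

theorem exp_apply_hasSum (T : V →L[ℝ] V) (x : V) :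
    HasSum (fun n : ℕ => ((n ! : ℝ)⁻¹) • (T ^ n) x) (NormedSpace.exp T x) := by
  have h := NormedSpace.exp_series_hasSum_exp' (𝕂 := ℝ) T
  exact h.mapL (ContinuousLinearMap.apply ℝ V x)

theorem evs_apply_hasSum {c : ℕ → ℝ} (hc : CoefOK c) (T : V →L[ℝ] V) (x : V) :
    HasSum (fun n : ℕ => c n • (T ^ (2 * n)) x) (evs c T x) := by
  have h := evs_hasSum hc clm_one_le T
  exact h.mapL (ContinuousLinearMap.apply ℝ V x)

theorem intertw_pow {T : V →L[ℝ] V} {S : W →L[ℝ] W} {J : V →L[ℝ] W}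
    (h : ∀ x, J (T x) = S (J x)) (n : ℕ) (x : V) : J ((T ^ n) x) = (S ^ n) (J x) := by
  induction n generalizing x with
  | zero => simp
  | succ n ih => rw [pow_succ, pow_succ, mul_apply_eq_comp,
      mul_apply_eq_comp, ih, h]

theorem intertw_exp {T : V →L[ℝ] V} {S : W →L[ℝ] W} {J : V →L[ℝ] W}
    (h : ∀ x, J (T x) = S (J x)) (x : V) :
    J (NormedSpace.exp T x) = NormedSpace.exp S (J x) := by
  have h1 := J.hasSum (exp_apply_hasSum T x)
  have h2 := exp_apply_hasSum S (J x)
  simp only [map_smul, intertw_pow h] at h1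
  exact h1.unique h2

theorem intertw_evs {c : ℕ → ℝ} (hc : CoefOK c) {T : V →L[ℝ] V} {S : W →L[ℝ] W} {J : V →L[ℝ] W}
    (h : ∀ x, J (T x) = S (J x)) (x : V) :
    J (evs c T x) = evs c S (J x) := by
  have h1 := J.hasSum (evs_apply_hasSum hc T x)
  have h2 := evs_apply_hasSum hc S (J x)
  simp only [map_smul, intertw_pow h] at h1
  exact h1.unique h2

theorem evs_mem {c : ℕ → ℝ} (hc : CoefOK c) {T : V →L[ℝ] V} {K : Submodule ℝ V}
    (hK : IsClosed (K : Set V)) (h : ∀ x ∈ K, T (T x) ∈ K) {x : V} (hx : x ∈ K) :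
    evs c T x ∈ K := by
  have hp : ∀ n : ℕ, (T ^ (2 * n)) x ∈ K := by
    intro n
    induction n with
    | zero => simpa using hx
    | succ n ih =>
      have : (T ^ (2 * (n + 1))) x = T (T ((T ^ (2 * n)) x)) := by
        rw [show 2 * (n + 1) = (2 * n + 1) + 1 by ring, pow_succ', pow_succ']
        rfl
      rw [this]; exact h _ ih
  refine hK.mem_of_tendsto (evs_apply_hasSum hc T x) (Eventually.of_forall fun s => ?_)
  exact K.sum_mem fun n _ => K.smul_mem _ (hp n)

end gen

section genI
variable {V : Type*} [NormedAddCommGroup V] [InnerProductSpace ℝ V] [CompleteSpace V]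

theorem symm_pow {T : V →L[ℝ] V} (h : ∀ x y, inner ℝ (T x) y = inner ℝ x (T y)) (n : ℕ) (x y : V) :
    inner ℝ ((T ^ n) x) y = inner ℝ x ((T ^ n) y) := by
  induction n generalizing x y with
  | zero => simp
  | succ n ih => rw [pow_succ', mul_apply_eq_comp, h, ih, ← mul_apply_eq_comp, ← pow_succ, ← pow_succ']

theorem shc_coercive {T : V →L[ℝ] V} (h : ∀ x y, inner ℝ (T x) y = inner ℝ x (T y)) (x : V) :
    ‖x‖ ^ 2 ≤ inner ℝ (evs shcC T x) x := by
  have h1 := evs_apply_hasSum shcC_ok T x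
  have h2 := (innerSL ℝ x).hasSum h1
  have h3 : inner ℝ (evs shcC T x) x = innerSL ℝ x (evs shcC T x) := by
    rw [innerSL_apply_apply, real_inner_comm]
  rw [h3]
  have h4 : ‖x‖ ^ 2 = (innerSL ℝ x) (shcC 0 • (T ^ (2 * 0)) x) := by
    simp [shcC]
  rw [h4]
  refine le_hasSum h2 0 fun k _ => ?_
  simp only [map_smul, innerSL_apply_apply, smul_eq_mul]
  have : inner ℝ x ((T ^ (2 * k)) x) = ‖(T ^ k) x‖ ^ 2 := by
    rw [two_mul, pow_add, mul_apply_eq_comp, ← symm_pow h, real_inner_self_eq_norm_sq]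
  rw [this]
  unfold shcC
  positivity

theorem shc_norm_ge {T : V →L[ℝ] V} (h : ∀ x y, inner ℝ (T x) y = inner ℝ x (T y)) (x : V) :
    ‖x‖ ≤ ‖evs shcC T x‖ := by
  have h1 := shc_coercive h x
  have h2 := real_inner_le_norm (evs shcC T x) x
  by_cases hx : ‖x‖ = 0
  · rw [hx]; positivity
  have : 0 < ‖x‖ := lt_of_le_of_ne (norm_nonneg _) (Ne.symm hx)
  nlinarith

end genI

theorem lmB_pow (a M : H →L[ℂ] H) (n : ℕ) : (lmB a ^ n) M = a ^ n * M := by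
  induction n generalizing M with
  | zero => simp
  | succ n ih => rw [pow_succ, mul_apply_eq_comp, ih, lmB_apply, pow_succ, mul_assoc]

theorem rmB_pow (a M : H →L[ℂ] H) (n : ℕ) : (rmB a ^ n) M = M * a ^ n := by
  induction n generalizing M with
  | zero => simp
  | succ n ih => rw [pow_succ, mul_apply_eq_comp, ih, rmB_apply, pow_succ', mul_assoc]

theorem exp_lmB (a M : H →L[ℂ] H) : NormedSpace.exp (lmB a) M = NormedSpace.exp a * M := by
  refine (exp_apply_hasSum (lmB a) M).unique ?_
  have h := (rmB M).hasSum (NormedSpace.exp_series_hasSum_exp' (𝕂 := ℝ) a)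
  simp only [map_smul, rmB_apply] at h
  simpa only [lmB_pow] using h

theorem exp_rmB (a M : H →L[ℂ] H) : NormedSpace.exp (rmB a) M = M * NormedSpace.exp a := by
  refine (exp_apply_hasSum (rmB a) M).unique ?_
  have h := (lmB M).hasSum (NormedSpace.exp_series_hasSum_exp' (𝕂 := ℝ) a)
  simp only [map_smul, lmB_apply] at h
  simpa only [rmB_pow] using h

theorem exp_lrB (a b M : H →L[ℂ] H) :
    NormedSpace.exp (lmB a + rmB b) M = NormedSpace.exp a * M * NormedSpace.exp b := by
  have hc : Commute (lmB a) (rmB b) := by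
    ext1 M
    simp only [mul_apply_eq_comp, lmB_apply, rmB_apply, mul_assoc]
  rw [rexp_add hc, mul_apply_eq_comp, exp_lmB, exp_rmB, mul_assoc]

theorem exp_lrH (e : HilbertBasis ι ℂ H) (a b : H →L[ℂ] H) (M : HSO e) :
    (NormedSpace.exp (lmH e a + rmH e b) M).op
      = NormedSpace.exp a * M.op * NormedSpace.exp b := by
  rw [← exp_lrB]
  exact intertw_exp (J := HSO.incl e) (fun x => rfl) M

/-- `½(L_a - R_b)`. -/
def DH (e : HilbertBasis ι ℂ H) (a b : H →L[ℂ] H) : HSO e →L[ℝ] HSO e :=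
  lmH e ((1 / 2 : ℝ) • a) + rmH e (-((1 / 2 : ℝ) • b))

theorem DH_norm (e : HilbertBasis ι ℂ H) (a b : H →L[ℂ] H) : ‖DH e a b‖ ≤ (‖a‖ + ‖b‖) / 2 := by
  refine (norm_add_le _ _).trans ?_
  have h1 := lmH_norm e ((1 / 2 : ℝ) • a)
  have h2 := rmH_norm e (-((1 / 2 : ℝ) • b))
  rw [norm_neg, norm_smul] at h2
  rw [norm_smul] at h1
  norm_num at h1 h2
  linarith

/-- Lemma A. -/
theorem lemmaA (e : HilbertBasis ι ℂ H) (A B : HSO e) :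
    (evs shcC (DH e A.op B.op) (A - B)).op =
      NormedSpace.exp ((1 / 2 : ℝ) • A.op) * NormedSpace.exp (-((1 / 2 : ℝ) • B.op)) -
      NormedSpace.exp (-((1 / 2 : ℝ) • A.op)) * NormedSpace.exp ((1 / 2 : ℝ) • B.op) := by
  set T' := lmB ((1 / 2 : ℝ) • A.op) + rmB (-((1 / 2 : ℝ) • B.op)) with hT'
  have h1 : (evs shcC (DH e A.op B.op) (A - B)).op = evs shcC T' (A.op - B.op) :=
    intertw_evs (J := HSO.incl e) shcC_ok (fun x => rfl) (A - B)
  have h2 : A.op - B.op = (2 : ℝ) • T' 1 := by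
    rw [hT', add_apply, lmB_apply, rmB_apply, mul_one, one_mul]
    module
  have h3 := congrArg (fun S => S (1 : H →L[ℂ] H)) (two_mul_shc clm_one_le T')
  simp only [smul_apply, mul_apply_eq_comp, sub_apply] at h3
  rw [h1, h2, map_smul, h3]
  have h4 : -T' = lmB (-((1 / 2 : ℝ) • A.op)) + rmB ((1 / 2 : ℝ) • B.op) := by
    ext1 M
    simp only [hT', neg_apply, add_apply, lmB_apply, rmB_apply]
    rw [neg_mul, mul_neg]; abel
  rw [h4, hT', exp_lrB, exp_lrB, mul_one, mul_one]

theorem chc_formula (e : HilbertBasis ι ℂ H) (a b : H →L[ℂ] H) (M : HSO e) :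
    ((2 : ℝ) • evs chcC (DH e a b) M).op =
      NormedSpace.exp ((1 / 2 : ℝ) • a) * M.op * NormedSpace.exp (-((1 / 2 : ℝ) • b)) +
      NormedSpace.exp (-((1 / 2 : ℝ) • a)) * M.op * NormedSpace.exp ((1 / 2 : ℝ) • b) := by
  have h3 := congrArg (fun S => S M) (two_chc clm_one_le (DH e a b))
  simp only [smul_apply, add_apply] at h3
  rw [h3, HSO.op_add]
  have h4 : -DH e a b = lmH e (-((1 / 2 : ℝ) • a)) + rmH e ((1 / 2 : ℝ) • b) := by
    ext1 M
    apply HSO.ext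
    simp only [DH, neg_apply, add_apply, HSO.op_neg, HSO.op_add, lmH_op, rmH_op]
    rw [neg_mul, mul_neg]; abel
  rw [h4, DH, exp_lrH, exp_lrH]

/-- Adjoint as an isometry of the HS operators. -/
def starHS (e : HilbertBasis ι ℂ H) : HSO e →ₗᵢ[ℝ] HSO e where
  toFun M := HSO.mk (star M.op) M.hs.star
  map_add' _ _ := HSO.ext (star_add _ _)
  map_smul' r M := HSO.ext (by
    simp only [HSO.op_mk, HSO.op_smul, RingHom.id_apply]
    rw [star_smul, star_trivial])
  norm_map' M := by
    rw [HSO.norm_def, HSO.norm_def]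
    have h1 := hs2_eq e M.hs
    have h2 := hs2_eq e M.hs.star
    rw [hs2_star, h1, ENNReal.ofReal_eq_ofReal_iff (by positivity) (by positivity)] at h2
    exact ((sq_eq_sq₀ (hsNorm_nonneg _ _) (hsNorm_nonneg _ _)).1 h2).symm

theorem lmH_symm (e : HilbertBasis ι ℂ H) {a : H →L[ℂ] H} (ha : IsSelfAdjoint a) (M N : HSO e) :
    inner ℝ (lmH e a M) N = inner ℝ M (lmH e a N) := by
  rw [HSO.inner_def, HSO.inner_def, lmH_op, lmH_op]
  unfold hsInner
  congr 1
  refine tsum_congr fun i => ?_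
  rw [mul_apply_eq_comp, mul_apply_eq_comp,
    ← ContinuousLinearMap.adjoint_inner_right, ← ContinuousLinearMap.star_eq_adjoint, ha.star_eq]

theorem rmH_symm (e : HilbertBasis ι ℂ H) {a : H →L[ℂ] H} (ha : IsSelfAdjoint a) (M N : HSO e) :
    inner ℝ (rmH e a M) N = inner ℝ M (rmH e a N) := by
  have key : ∀ M, starHS e (rmH e a M) = lmH e a (starHS e M) := by
    intro M
    apply HSO.ext
    change star (M.op * a) = a * star M.op
    rw [star_mul, ha.star_eq]
  rw [← (starHS e).inner_map_map, key, lmH_symm e ha, ← key, (starHS e).inner_map_map]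

theorem DH_symm (e : HilbertBasis ι ℂ H) {a b : H →L[ℂ] H} (ha : IsSelfAdjoint a)
    (hb : IsSelfAdjoint b) (M N : HSO e) :
    inner ℝ (DH e a b M) N = inner ℝ M (DH e a b N) := by
  have ha' : IsSelfAdjoint ((1 / 2 : ℝ) • a) := (IsSelfAdjoint.all (1 / 2 : ℝ)).smul ha
  have hb' : IsSelfAdjoint (-((1 / 2 : ℝ) • b)) := ((IsSelfAdjoint.all (1 / 2 : ℝ)).smul hb).neg
  simp only [DH, add_apply, inner_add_left, inner_add_right, lmH_symm e ha', rmH_symm e hb']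

/-- The basic inequality. -/
theorem log_lip (e : HilbertBasis ι ℂ H) {a b : H →L[ℂ] H} (ha : MemS2 e a) (hb : MemS2 e b) :
    hsNorm e (a - b) ≤ hsNorm e (
      NormedSpace.exp ((1 / 2 : ℝ) • a) * NormedSpace.exp (-((1 / 2 : ℝ) • b)) -
      NormedSpace.exp (-((1 / 2 : ℝ) • a)) * NormedSpace.exp ((1 / 2 : ℝ) • b)) := by
  have h := shc_norm_ge (DH_symm e ha.1 hb.1) (HSO.mk a ha.2 - HSO.mk b hb.2)
  have h2 := lemmaA e (HSO.mk a ha.2) (HSO.mk b hb.2)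
  rw [HSO.norm_def, HSO.norm_def] at h
  simp only [HSO.op_mk] at h2
  rw [h2] at h
  exact h

end Super


/-! ### Exponentials, logarithms and the cone `P` -/

section ExpLog

set_option linter.unusedSectionVars false
open Filter Topology
open NormedSpace (exp)

theorem oneB : ‖(1 : H →L[ℂ] H)‖ ≤ 1 := ContinuousLinearMap.norm_id_le

/-- `e^{V/2}` -/
def eh (V : H →L[ℂ] H) : H →L[ℂ] H := exp ((1 / 2 : ℝ) • V)
/-- `e^{-V/2}` -/
def ei (V : H →L[ℂ] H) : H →L[ℂ] H := exp (-((1 / 2 : ℝ) • V))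

theorem eh_mul_ei (V : H →L[ℂ] H) : eh V * ei V = 1 := rexp_mul_neg _
theorem ei_mul_eh (V : H →L[ℂ] H) : ei V * eh V = 1 := rexp_neg_mul _
theorem eh_mul_eh (V : H →L[ℂ] H) : eh V * eh V = exp V := by
  unfold eh
  rw [← rexp_add (Commute.refl _), ← add_smul]; norm_num
theorem ei_mul_ei (V : H →L[ℂ] H) : ei V * ei V = exp (-V) := by
  unfold ei
  rw [← rexp_add (Commute.refl _), ← neg_add, ← add_smul]; norm_num
theorem ei_mul_exp (V : H →L[ℂ] H) : ei V * exp V = eh V := by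
  rw [← eh_mul_eh, ← mul_assoc, ei_mul_eh, one_mul]
theorem exp_mul_ei (V : H →L[ℂ] H) : exp V * ei V = eh V := by
  rw [← eh_mul_eh, mul_assoc, eh_mul_ei, mul_one]
theorem eh_neg (V : H →L[ℂ] H) : eh (-V) = ei V := by unfold eh ei; rw [smul_neg]
theorem ei_neg (V : H →L[ℂ] H) : ei (-V) = eh V := by unfold eh ei; rw [smul_neg, neg_neg]
theorem sa_smul {V : H →L[ℂ] H} (h : IsSelfAdjoint V) (r : ℝ) : IsSelfAdjoint (r • V) :=
  (IsSelfAdjoint.all r).smul h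
theorem eh_sa {V : H →L[ℂ] H} (h : IsSelfAdjoint V) : IsSelfAdjoint (eh V) := (sa_smul h _).exp
theorem ei_sa {V : H →L[ℂ] H} (h : IsSelfAdjoint V) : IsSelfAdjoint (ei V) := (sa_smul h _).neg.exp
theorem eh_unit (V : H →L[ℂ] H) : IsUnit (eh V) := rexp_isUnit _
theorem ei_unit (V : H →L[ℂ] H) : IsUnit (ei V) := rexp_isUnit _

theorem MemS2.smul {e : HilbertBasis ι ℂ H} {V : H →L[ℂ] H} (h : MemS2 e V) (r : ℝ) :
    MemS2 e (r • V) := ⟨sa_smul h.1 r, h.2.smul r⟩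
theorem MemS2.neg {e : HilbertBasis ι ℂ H} {V : H →L[ℂ] H} (h : MemS2 e V) :
    MemS2 e (-V) := ⟨h.1.neg, h.2.neg⟩

theorem exp_sub_one (V : H →L[ℂ] H) : exp V - 1 = eh V * evs shcC ((1 / 2 : ℝ) • V) * V := by
  have h := two_mul_shc oneB ((1 / 2 : ℝ) • V)
  have h2 : (2 : ℝ) • (evs shcC ((1 / 2 : ℝ) • V) * ((1 / 2 : ℝ) • V))
      = evs shcC ((1 / 2 : ℝ) • V) * V := by
    rw [mul_smul_comm, smul_smul]; norm_num
  rw [h2] at h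
  rw [mul_assoc, h]
  change _ = eh V * (eh V - ei V)
  rw [mul_sub, eh_mul_eh, eh_mul_ei]

theorem exp_sub_one_hs {e : HilbertBasis ι ℂ H} {V : H →L[ℂ] H} (h : IsHS e V) :
    IsHS e (exp V - 1) := by
  rw [exp_sub_one]; exact (h.mul_left _).1

theorem expB_nonneg {V : H →L[ℂ] H} (h : IsSelfAdjoint V) : 0 ≤ exp V := by
  rw [← eh_mul_eh]
  nth_rw 1 [← (eh_sa h).star_eq]
  exact star_mul_self_nonneg _

theorem MemP.nonneg {e : HilbertBasis ι ℂ H} {p : H →L[ℂ] H} (h : MemP e p) : 0 ≤ p := by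
  rw [ContinuousLinearMap.nonneg_iff_isPositive, ContinuousLinearMap.isPositive_def']
  exact ⟨h.1, h.2.2.1⟩

theorem memP_of {e : HilbertBasis ι ℂ H} {p : H →L[ℂ] H} (h : 0 ≤ p) (hu : IsUnit p)
    (hs : IsHS e (p - 1)) : MemP e p := by
  rw [ContinuousLinearMap.nonneg_iff_isPositive, ContinuousLinearMap.isPositive_def'] at h
  exact ⟨h.1, hu, h.2, hs⟩

theorem memP_exp {e : HilbertBasis ι ℂ H} {V : H →L[ℂ] H} (h : MemS2 e V) : MemP e (exp V) :=
  memP_of (expB_nonneg h.1) (rexp_isUnit V) (exp_sub_one_hs h.2)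

theorem plog_sa (p : H →L[ℂ] H) : IsSelfAdjoint (plog p) := cfc_predicate _ _

theorem plog_exp {V : H →L[ℂ] H} (h : IsSelfAdjoint V) : plog (exp V) = V := CFC.log_exp V

theorem exp_plog {e : HilbertBasis ι ℂ H} {p : H →L[ℂ] H} (h : MemP e p) : exp (plog p) = p :=
  CFC.exp_log p (h.2.1.isStrictlyPositive h.nonneg)

theorem plog_hs {e : HilbertBasis ι ℂ H} {p : H →L[ℂ] H} (h : MemP e p) : IsHS e (plog p) := by
  have hpos : ∀ x ∈ spectrum ℝ p, 0 < x :=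
    (StarOrderedRing.isStrictlyPositive_iff_spectrum_pos (R := ℝ) p h.1).1
      (h.2.1.isStrictlyPositive h.nonneg)
  have hsub : spectrum ℝ p ⊆ Set.Ioi 0 := fun x hx => hpos x hx
  have hcont : ContinuousOn (dslope Real.log 1) (spectrum ℝ p) := by
    have : ContinuousOn (dslope Real.log 1) (Set.Ioi 0) := by
      rw [continuousOn_dslope (Ioi_mem_nhds one_pos)]
      refine ⟨Real.continuousOn_log.mono fun x hx => ?_, Real.differentiableAt_log one_ne_zero⟩
      exact ne_of_gt hx
    exact this.mono hsub
  have h1 : plog p = cfc (fun t : ℝ => dslope Real.log 1 t * (t - 1)) p := by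
    unfold plog
    congr 1
    funext t
    have := sub_smul_dslope Real.log 1 t
    rw [Real.log_one, sub_zero, smul_eq_mul] at this
    rw [mul_comm, this]
  have hid : cfc (fun t : ℝ => t - 1) p = p - 1 := by
    rw [cfc_sub (fun t : ℝ => t) (fun _ => (1 : ℝ)) p, cfc_id' ℝ p h.1, cfc_const_one ℝ p h.1]
  rw [h1, cfc_mul _ _ p hcont (by fun_prop), hid]
  exact (h.2.2.2.mul_left _).1

theorem plog_mem {e : HilbertBasis ι ℂ H} {p : H →L[ℂ] H} (h : MemP e p) : MemS2 e (plog p) :=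
  ⟨plog_sa p, plog_hs h⟩

theorem memP_iff {e : HilbertBasis ι ℂ H} {p : H →L[ℂ] H} (h : MemP e p) :
    ∃ V, MemS2 e V ∧ exp V = p := ⟨plog p, plog_mem h, exp_plog h⟩

theorem memP_conj {e : HilbertBasis ι ℂ H} {q g : H →L[ℂ] H} (hq : MemP e q) (hg : IsUnit g)
    (hs : IsHS e (g - 1)) : MemP e (g * q * star g) := by
  refine memP_of ?_ ((hg.mul hq.2.1).mul hg.star) ?_
  · exact star_right_conjugate_nonneg hq.nonneg g
  · have h1 : g * q * star g - 1 = g * (q - 1) * star g + ((g - 1) * star g + star (g - 1)) := by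
      rw [star_sub, star_one]; noncomm_ring
    rw [h1]
    exact ((hq.2.2.2.mul_left g).1.mul_right _).1.add (((hs.mul_right _).1).add hs.star)

theorem pinvsqrt_exp {V : H →L[ℂ] H} (h : IsSelfAdjoint V) : pinvsqrt (exp V) = ei V := by
  have hu : ∀ x ∈ spectrum ℝ (exp V), 0 < x :=
    (StarOrderedRing.isStrictlyPositive_iff_spectrum_pos (R := ℝ) (exp V) h.exp).1
      ((rexp_isUnit V).isStrictlyPositive (expB_nonneg h))
  have h1 : ei V = cfc (fun t : ℝ => Real.exp (-((1 / 2) * t))) V := by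
    unfold ei
    rw [← CFC.real_exp_eq_normedSpace_exp (sa_smul h _).neg,
      cfc_comp' Real.exp (fun t : ℝ => -((1 / 2) * t)) V, cfc_neg, cfc_const_mul _ _ V, cfc_id' ℝ V]
  have hc : ContinuousOn (fun t : ℝ => (Real.sqrt t)⁻¹) (Real.exp '' spectrum ℝ V) := by
    refine ContinuousOn.inv₀ (by fun_prop) ?_
    rintro _ ⟨x, -, rfl⟩
    exact (Real.sqrt_pos.2 (Real.exp_pos x)).ne'
  unfold pinvsqrt
  rw [← CFC.real_exp_eq_normedSpace_exp h, ← cfc_comp' (fun t : ℝ => (Real.sqrt t)⁻¹) Real.exp V hc,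
    h1]
  congr 1
  funext t
  rw [Real.exp_neg, mul_comm, ← div_eq_mul_one_div, Real.exp_half]

theorem norm_le_of_exp {V : H →L[ℂ] H} (h : IsSelfAdjoint V) {R : ℝ} (hR : 0 ≤ R)
    (h1 : ‖exp V‖ ≤ Real.exp R) (h2 : ‖exp (-V)‖ ≤ Real.exp R) : ‖V‖ ≤ R := by
  have key : ∀ W : H →L[ℂ] H, IsSelfAdjoint W → ‖exp W‖ ≤ Real.exp R →
      ∀ x ∈ spectrum ℝ W, x ≤ R := by
    intro W hW hb x hx
    have := norm_apply_le_norm_cfc Real.exp W hx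
    rw [CFC.real_exp_eq_normedSpace_exp hW] at this
    have h3 := this.trans hb
    rw [Real.norm_eq_abs, Real.abs_exp] at h3
    exact Real.exp_le_exp.1 h3
  rw [← cfc_id' ℝ V h]
  refine norm_cfc_le hR fun x hx => ?_
  rw [Real.norm_eq_abs, abs_le]
  refine ⟨?_, key V h h1 x hx⟩
  have : -x ∈ spectrum ℝ (-V) := by
    rw [← spectrum.neg_eq]; simpa using hx
  have := key (-V) h.neg h2 (-x) this
  linarith

theorem unitary_norm_le {u : H →L[ℂ] H} (h : star u * u = 1) : ‖u‖ ≤ 1 := by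
  have := CStarRing.norm_star_mul_self (x := u)
  rw [h] at this
  have h1 := oneB (H := H)
  nlinarith [norm_nonneg u]

theorem hsNorm_unitary_le (e : HilbertBasis ι ℂ H) {u w Z : H →L[ℂ] H} (hu : star u * u = 1)
    (hw : star w * w = 1) (hZ : IsHS e Z) : IsHS e (w * Z * star u) ∧
    hsNorm e (w * Z * star u) ≤ hsNorm e Z := by
  have h1 := hZ.mul_left w
  have h2 := h1.1.mul_right (star u)
  refine ⟨h2.1, h2.2.trans ?_⟩
  have h3 := unitary_norm_le hu
  have h4 := unitary_norm_le hw
  rw [norm_star]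
  have h5 := hsNorm_nonneg e Z
  have h6 := hsNorm_nonneg e (w * Z)
  calc hsNorm e (w * Z) * ‖u‖ ≤ hsNorm e (w * Z) * 1 := by gcongr
    _ ≤ (‖w‖ * hsNorm e Z) * 1 := by gcongr; exact h1.2
    _ ≤ (1 * hsNorm e Z) * 1 := by gcongr
    _ = _ := by ring

/-- From `u u* = 1` and invertibility. -/
theorem unit_star {u : H →L[ℂ] H} (hu : IsUnit u) (h : u * star u = 1) : star u * u = 1 := by
  obtain ⟨v, rfl⟩ := hu
  have : star (v : H →L[ℂ] H) = ↑v⁻¹ := by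
    rw [← Units.inv_mul_cancel_left v (star (v : H →L[ℂ] H)), h, mul_one]
  rw [this, Units.inv_mul]

/-- Computation of the distance via an arbitrary square root. -/
theorem gdist_eq {e : HilbertBasis ι ℂ H} {V Z k : H →L[ℂ] H} (hV : IsSelfAdjoint V)
    (hZ : MemS2 e Z) (hk : IsUnit k) (hkk : k * star k = exp V) :
    gdist e (exp V) (k * exp Z * star k) = hsNorm e Z := by
  set u := ei V * k with hu
  have huu : u * star u = 1 := by
    rw [hu, star_mul, (ei_sa hV).star_eq]
    calc ei V * k * (star k * ei V) = ei V * (k * star k) * ei V := by noncomm_ring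
      _ = 1 := by rw [hkk, ei_mul_exp, eh_mul_ei]
  have hU : IsUnit u := (ei_unit V).mul hk
  have huu' := unit_star hU huu
  let U : (H →L[ℂ] H)ˣ := ⟨u, star u, huu, huu'⟩
  have h1 : ei V * (k * exp Z * star k) * ei V = exp (u * Z * star u) := by
    let _ := NormedAlgebra.restrictScalars ℚ ℝ (H →L[ℂ] H)
    have h2 := NormedSpace.exp_units_conj U Z
    have h3 : exp (u * Z * star u) = u * exp Z * star u := h2
    rw [h3, hu, star_mul, (ei_sa hV).star_eq]
    noncomm_ring
  unfold gdist
  rw [pinvsqrt_exp hV, h1, plog_exp (hZ.1.conjugate u)]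
  have a1 := hsNorm_unitary_le e huu' huu' hZ.2
  refine le_antisymm a1.2 ?_
  have s : star (star u) * star u = 1 := by rw [star_star]; exact huu
  have a2 := (hsNorm_unitary_le e s s a1.1).2
  have : star u * (u * Z * star u) * star (star u) = Z := by
    rw [star_star]
    calc star u * (u * Z * star u) * u = (star u * u) * Z * (star u * u) := by noncomm_ring
      _ = Z := by rw [huu', one_mul, mul_one]
  rw [this] at a2
  exact a2

end ExpLog


/-! ### The exponential metric increasing property -/

section EMI

set_option linter.unusedSectionVars false
open Filter Topology
open NormedSpace (exp)

theorem eh_sub_ei (V : H →L[ℂ] H) : eh V - ei V = evs shcC ((1 / 2 : ℝ) • V) * V := by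
  have h := two_mul_shc oneB ((1 / 2 : ℝ) • V)
  have h2 : (2 : ℝ) • (evs shcC ((1 / 2 : ℝ) • V) * ((1 / 2 : ℝ) • V))
      = evs shcC ((1 / 2 : ℝ) • V) * V := by
    rw [mul_smul_comm, smul_smul]; norm_num
  rw [h2] at h
  exact h.symm

theorem half_smul_norm (V : H →L[ℂ] H) : ‖(1 / 2 : ℝ) • V‖ = ‖V‖ / 2 := by
  rw [norm_smul]; norm_num; ring

theorem emi_step {e : HilbertBasis ι ℂ H} {A B Z k : H →L[ℂ] H} (hA : MemS2 e A) (hB : MemS2 e B)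
    (hZ : MemS2 e Z) (hk : IsUnit k) (h1 : k * star k = exp A)
    (h2 : k * exp Z * star k = exp B) :
    hsNorm e (B - A) ≤ hsNorm e Z * Real.exp (‖Z‖ / 2) := by
  have h := log_lip e hB hA
  change _ ≤ hsNorm e (eh B * ei A - ei B * eh A) at h
  set u := ei A * k with hu
  set w := ei B * k * eh Z with hw
  have su : star u = star k * ei A := by rw [hu, star_mul, (ei_sa hA.1).star_eq]
  have sw : star w = eh Z * star k * ei B := by
    rw [hw, star_mul, star_mul, (ei_sa hB.1).star_eq, (eh_sa hZ.1).star_eq, mul_assoc]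
  have huu : u * star u = 1 := by
    rw [su, hu]
    calc ei A * k * (star k * ei A) = ei A * (k * star k) * ei A := by noncomm_ring
      _ = 1 := by rw [h1, ei_mul_exp, eh_mul_ei]
  have hww : w * star w = 1 := by
    rw [sw, hw]
    calc ei B * k * eh Z * (eh Z * star k * ei B)
        = ei B * (k * (eh Z * eh Z) * star k) * ei B := by noncomm_ring
      _ = 1 := by rw [eh_mul_eh, h2, ei_mul_exp, eh_mul_ei]
  have huu' := unit_star ((ei_unit A).mul hk) huu
  have hww' := unit_star (((ei_unit B).mul hk).mul (eh_unit Z)) hww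
  have e1 : eh B * ei A = w * eh Z * star u := by
    rw [su, hw]
    calc eh B * ei A = ei B * exp B * ei A := by rw [ei_mul_exp]
      _ = ei B * (k * (eh Z * eh Z) * star k) * ei A := by rw [eh_mul_eh, h2]
      _ = _ := by noncomm_ring
  have e2 : ei B * eh A = w * ei Z * star u := by
    rw [su, hw]
    calc ei B * eh A = ei B * (exp A * ei A) := by rw [exp_mul_ei]
      _ = ei B * (k * 1 * star k * ei A) := by rw [mul_one, h1]
      _ = ei B * (k * (eh Z * ei Z) * star k * ei A) := by rw [eh_mul_ei]
      _ = _ := by noncomm_ring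
  have e3 : eh B * ei A - ei B * eh A = w * (evs shcC ((1 / 2 : ℝ) • Z) * Z) * star u := by
    rw [e1, e2, ← eh_sub_ei]; noncomm_ring
  rw [e3] at h
  have h3 := hZ.2.mul_left (evs shcC ((1 / 2 : ℝ) • Z))
  refine h.trans ((hsNorm_unitary_le e huu' hww' h3.1).2.trans (h3.2.trans ?_))
  rw [mul_comm]
  have h4 := evs_norm_le shcC_ok oneB ((1 / 2 : ℝ) • Z)
  rw [half_smul_norm] at h4
  have := hsNorm_nonneg e Z
  gcongr

theorem conj_mem {e : HilbertBasis ι ℂ H} {V Z : H →L[ℂ] H} (hV : MemS2 e V) (hZ : MemS2 e Z) :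
    MemP e (eh V * exp Z * eh V) := by
  have := memP_conj (g := eh V) (memP_exp hZ) (eh_unit V) (exp_sub_one_hs (hV.2.smul _))
  rwa [(eh_sa hV.1).star_eq] at this

theorem gdist_Z {e : HilbertBasis ι ℂ H} {V W : H →L[ℂ] H} (hV : MemS2 e V) (hW : MemS2 e W) :
    ∃ Z, MemS2 e Z ∧ exp Z = ei V * exp W * ei V ∧ eh V * exp Z * eh V = exp W ∧
      gdist e (exp V) (exp W) = hsNorm e Z := by
  have h := conj_mem hV.neg hW
  rw [eh_neg] at h
  obtain ⟨Z, hZ, hZe⟩ := memP_iff h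
  have h3 : eh V * exp Z * eh V = exp W := by
    rw [hZe]
    calc eh V * (ei V * exp W * ei V) * eh V = (eh V * ei V) * exp W * (ei V * eh V) := by
          noncomm_ring
      _ = exp W := by rw [eh_mul_ei, ei_mul_eh, one_mul, mul_one]
  refine ⟨Z, hZ, hZe, h3, ?_⟩
  have := gdist_eq (k := eh V) hV.1 hZ (eh_unit V) (by rw [(eh_sa hV.1).star_eq, eh_mul_eh])
  rwa [(eh_sa hV.1).star_eq, h3] at this

theorem emi {e : HilbertBasis ι ℂ H} {V W : H →L[ℂ] H} (hV : MemS2 e V) (hW : MemS2 e W) :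
    hsNorm e (V - W) ≤ gdist e (exp V) (exp W) := by
  obtain ⟨Z, hZ, hZe, hW2, hd⟩ := gdist_Z hV hW
  rw [hd]
  set x : ℝ → H →L[ℂ] H := fun t => eh V * exp (t • Z) * eh V with hx
  have hxm : ∀ t, MemP e (x t) := fun t => conj_mem hV (hZ.smul t)
  set L : ℝ → H →L[ℂ] H := fun t => plog (x t) with hL
  have hLm : ∀ t, MemS2 e (L t) := fun t => plog_mem (hxm t)
  have hLe : ∀ t, exp (L t) = x t := fun t => exp_plog (hxm t)
  have hL0 : L 0 = V := by
    simp only [hL, hx, zero_smul, NormedSpace.exp_zero, mul_one, eh_mul_eh]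
    exact plog_exp hV.1
  have hL1 : L 1 = W := by
    simp only [hL, hx, one_smul, hW2]
    exact plog_exp hW.1
  have step : ∀ t δ : ℝ, 0 ≤ δ → hsNorm e (L (t + δ) - L t) ≤
      δ * hsNorm e Z * Real.exp (δ * ‖Z‖ / 2) := by
    intro t δ hδ
    have hs : star (eh V * exp ((t / 2) • Z)) = exp ((t / 2) • Z) * eh V := by
      rw [star_mul, (eh_sa hV.1).star_eq, (sa_smul hZ.1 (t / 2)).exp.star_eq]
    have := emi_step (k := eh V * exp ((t / 2) • Z)) (hLm t) (hLm (t + δ)) (hZ.smul δ)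
      ((eh_unit V).mul (rexp_isUnit _)) (by
        rw [hs, hLe, hx]
        calc eh V * exp ((t / 2) • Z) * (exp ((t / 2) • Z) * eh V)
            = eh V * (exp ((t / 2) • Z) * exp ((t / 2) • Z)) * eh V := by noncomm_ring
          _ = _ := by rw [← rexp_smul_add, add_halves]) (by
        rw [hs, hLe, hx]
        calc eh V * exp ((t / 2) • Z) * exp (δ • Z) * (exp ((t / 2) • Z) * eh V)
            = eh V * (exp ((t / 2) • Z) * exp (δ • Z) * exp ((t / 2) • Z)) * eh V := by noncomm_ring
          _ = _ := by
            rw [← rexp_smul_add, ← rexp_smul_add, show t / 2 + δ + t / 2 = t + δ by ring])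
    rwa [hsNorm_smul _ hZ.2, norm_smul, Real.norm_eq_abs, abs_of_nonneg hδ] at this
  have key : ∀ n : ℕ, hsNorm e (V - W) ≤ hsNorm e Z * Real.exp ((1 / ((n : ℝ) + 1)) * (‖Z‖ / 2)) := by
    intro n
    set δ : ℝ := 1 / ((n : ℝ) + 1) with hδ
    have hδ0 : 0 ≤ δ := by positivity
    have hm : ∀ m : ℕ, hsNorm e (L (m * δ) - L 0) ≤
        m * (δ * hsNorm e Z * Real.exp (δ * ‖Z‖ / 2)) := by
      intro m
      induction m with
      | zero => simp [hsNorm]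
      | succ m ih =>
        have h1 := step (m * δ) δ hδ0
        have h2 := hsNorm_add_le ((hLm (m * δ + δ)).2.sub (hLm (m * δ)).2)
          ((hLm (m * δ)).2.sub (hLm 0).2)
        rw [sub_add_sub_cancel] at h2
        push_cast
        rw [add_mul, one_mul, add_mul]
        linarith
    have := hm (n + 1)
    have hn : ((n + 1 : ℕ) : ℝ) * δ = 1 := by
      rw [hδ]; push_cast; field_simp
    rw [← mul_assoc, ← mul_assoc, hn, one_mul, hL0, hL1, hsNorm_sub_rev, mul_div_assoc] at this
    exact this
  have lim : Tendsto (fun n : ℕ => hsNorm e Z * Real.exp ((1 / ((n : ℝ) + 1)) * (‖Z‖ / 2))) atTop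
      (𝓝 (hsNorm e Z * Real.exp (0 * (‖Z‖ / 2)))) := by
    refine Tendsto.const_mul _ ((Real.continuous_exp.tendsto _).comp ?_)
    exact tendsto_one_div_add_atTop_nhds_zero_nat.mul_const _
  rw [zero_mul, Real.exp_zero, mul_one] at lim
  exact ge_of_tendsto' lim key

end EMI


/-! ### Mostow's theorem: `exp E` is stable under `y ↦ e^X y e^X` -/

section Mostow

set_option linter.unusedSectionVars false
open Filter Topology
open NormedSpace (exp)

/-- The subspace `E` inside the HS operators. -/
def liftE (e : HilbertBasis ι ℂ H) (E : Submodule ℝ (H →L[ℂ] H)) : Submodule ℝ (HSO e) :=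
  E.comap (HSO.incl e).toLinearMap

theorem mem_liftE {e : HilbertBasis ι ℂ H} {E : Submodule ℝ (H →L[ℂ] H)} {A : HSO e} :
    A ∈ liftE e E ↔ A.op ∈ E := Iff.rfl

theorem liftE_closed {e : HilbertBasis ι ℂ H} {E : Submodule ℝ (H →L[ℂ] H)}
    (hE : ∀ X ∈ E, MemS2 e X) (hclosed : IsHSClosed e (E : Set (H →L[ℂ] H))) :
    IsClosed (liftE e E : Set (HSO e)) := by
  rw [← closure_subset_iff_isClosed]
  intro A hA
  have hsa : IsSelfAdjoint A.op := by
    have hcl : IsClosed {B : HSO e | star (HSO.incl e B) = HSO.incl e B} :=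
      isClosed_eq (continuous_star.comp (HSO.incl e).continuous) (HSO.incl e).continuous
    have : closure (liftE e E : Set (HSO e)) ⊆ {B : HSO e | star (HSO.incl e B) = HSO.incl e B} :=
      closure_minimal (fun B hB => (hE _ hB).1) hcl
    exact this hA
  refine hclosed A.op ⟨hsa, A.hs⟩ fun ε hε => ?_
  obtain ⟨B, hB, hd⟩ := Metric.mem_closure_iff.1 hA ε hε
  refine ⟨B.op, hB, ?_⟩
  rwa [dist_eq_norm, HSO.norm_def] at hd

theorem solve_shc {V : Type*} [NormedAddCommGroup V] [InnerProductSpace ℝ V] [CompleteSpace V]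
    {T : V →L[ℝ] V} (h : ∀ x y, inner ℝ (T x) y = inner ℝ x (T y)) {K : Submodule ℝ V}
    (hK : IsClosed (K : Set V)) (hT : ∀ x ∈ K, T (T x) ∈ K) {f : V} (hf : f ∈ K) :
    ∃ g ∈ K, evs shcC T g = f := by
  have : CompleteSpace K := hK.completeSpace_coe
  let S : K →L[ℝ] K := ((evs shcC T).comp K.subtypeL).codRestrict K
    (fun x => evs_mem shcC_ok hK hT x.2)
  let B : K →L[ℝ] K →L[ℝ] ℝ := (innerSL ℝ).comp S
  have hB : ∀ u v, B u v = inner ℝ (S u) v := fun u v => rfl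
  have hco : IsCoercive B := by
    refine ⟨1, one_pos, fun u => ?_⟩
    rw [hB, one_mul, ← sq]
    exact shc_coercive h (u : V)
  obtain ⟨g, hg⟩ := hco.continuousLinearEquivOfBilin.surjective ⟨f, hf⟩
  have hS : S g = ⟨f, hf⟩ := by
    rw [← hg]
    refine ext_inner_right ℝ fun v => ?_
    rw [hco.continuousLinearEquivOfBilin_apply, hB]
  exact ⟨g, g.2, congrArg Subtype.val hS⟩

theorem DH_sq_op (e : HilbertBasis ι ℂ H) (γ : H →L[ℂ] H) (M : HSO e) :
    (DH e γ γ (DH e γ γ M)).op = (1 / 4 : ℝ) • brk γ (brk γ M.op) := by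
  have h : ∀ M, (DH e γ γ M).op = (1 / 2 : ℝ) • brk γ M.op := by
    intro M
    simp only [DH, add_apply, HSO.op_add, lmH_op, rmH_op, brk]
    rw [smul_mul_assoc, mul_neg, mul_smul_comm, smul_sub, sub_eq_add_neg]
  rw [h, h]
  have h2 : brk γ ((1 / 2 : ℝ) • brk γ M.op) = (1 / 2 : ℝ) • brk γ (brk γ M.op) := by
    rw [brk, mul_smul_comm, smul_mul_assoc, ← smul_sub]; rfl
  rw [h2, smul_smul]; norm_num

theorem exp_sub_exp (e : HilbertBasis ι ℂ H) (A B : HSO e) :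
    exp A.op - exp B.op = eh A.op * (evs shcC (DH e A.op B.op) (A - B)).op * eh B.op := by
  rw [lemmaA]
  change _ = eh A.op * (eh A.op * ei B.op - ei A.op * eh B.op) * eh B.op
  calc exp A.op - exp B.op = (eh A.op * eh A.op) * (ei B.op * eh B.op) -
        (eh A.op * ei A.op) * (eh B.op * eh B.op) := by
        rw [eh_mul_eh, ei_mul_eh, eh_mul_ei, eh_mul_eh, mul_one, one_mul]
    _ = _ := by noncomm_ring

theorem eh_norm {V : H →L[ℂ] H} {R : ℝ} (h : ‖V‖ ≤ R) : ‖eh V‖ ≤ Real.exp (R / 2) := by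
  refine (rexp_norm_le oneB _).trans (Real.exp_le_exp.2 ?_)
  rw [half_smul_norm]; linarith

theorem ei_norm {V : H →L[ℂ] H} {R : ℝ} (h : ‖V‖ ≤ R) : ‖ei V‖ ≤ Real.exp (R / 2) := by
  rw [← eh_neg]; exact eh_norm (by rwa [norm_neg])

theorem exp_normR {V : H →L[ℂ] H} {R : ℝ} (h : ‖V‖ ≤ R) : ‖exp V‖ ≤ Real.exp R :=
  (rexp_norm_le oneB _).trans (Real.exp_le_exp.2 h)

theorem shcDH_norm (e : HilbertBasis ι ℂ H) {a b : H →L[ℂ] H} {R : ℝ} (ha : ‖a‖ ≤ R) (hb : ‖b‖ ≤ R)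
    (M : HSO e) : ‖evs shcC (DH e a b) M‖ ≤ Real.exp R * ‖M‖ := by
  refine (ContinuousLinearMap.le_opNorm _ _).trans ?_
  gcongr
  refine (evs_norm_le shcC_ok clm_one_le _).trans (Real.exp_le_exp.2 ?_)
  have := DH_norm e a b
  linarith

/-- three-factor HS bound -/
theorem hs_three {e : HilbertBasis ι ℂ H} {a M b : H →L[ℂ] H} {r s t : ℝ} (hM : IsHS e M)
    (ha : ‖a‖ ≤ r) (hm : hsNorm e M ≤ s) (hb : ‖b‖ ≤ t) :
    IsHS e (a * M * b) ∧ hsNorm e (a * M * b) ≤ r * s * t := by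
  have h1 := hM.mul_left a
  have h2 := h1.1.mul_right b
  refine ⟨h2.1, h2.2.trans ?_⟩
  have h3 := hsNorm_nonneg e M
  have h4 := hsNorm_nonneg e (a * M)
  have h5 := norm_nonneg a
  have h6 := norm_nonneg b
  have h7 : hsNorm e (a * M) ≤ r * s := h1.2.trans (by gcongr; linarith)
  have h8 : 0 ≤ r * s := h4.trans h7
  gcongr

theorem exp_lip {e : HilbertBasis ι ℂ H} {a b : H →L[ℂ] H} {R : ℝ} (ha : IsHS e a) (hb : IsHS e b)
    (hRa : ‖a‖ ≤ R) (hRb : ‖b‖ ≤ R) :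
    hsNorm e (exp a - exp b) ≤ Real.exp (2 * R) * hsNorm e (a - b) := by
  have h := exp_sub_exp e (HSO.mk a ha) (HSO.mk b hb)
  simp only [HSO.op_mk] at h
  rw [h]
  have h1 := shcDH_norm e hRa hRb (HSO.mk a ha - HSO.mk b hb)
  rw [HSO.norm_def, HSO.norm_def (_ - _)] at h1
  refine (hs_three (HSO.hs _) (eh_norm hRa) h1 (eh_norm hRb)).2.trans (le_of_eq ?_)
  rw [HSO.op_sub, HSO.op_mk, HSO.op_mk]
  have : Real.exp (2 * R) = Real.exp (R / 2) * Real.exp R * Real.exp (R / 2) := by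
    rw [← Real.exp_add, ← Real.exp_add]; ring_nf
  rw [this]; ring

/-- second order Taylor remainder -/
theorem exp_taylor {e : HilbertBasis ι ℂ H} {X : H →L[ℂ] H} (hX : IsHS e X) :
    ∃ C : ℝ, 0 ≤ C ∧ ∀ h : ℝ, 0 ≤ h → h ≤ 1 →
      IsHS e (exp (h • X) - 1 - h • X) ∧ hsNorm e (exp (h • X) - 1 - h • X) ≤ C * h ^ 2 := by
  set x := hsNorm e X with hx
  have hx0 : 0 ≤ x := hsNorm_nonneg e X
  have hXx : ‖X‖ ≤ x := norm_le_hsNorm e hX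
  refine ⟨(Real.exp (2 * x) * x * Real.exp x + Real.exp (2 * (x + 1)) * x) * x, by positivity,
    fun h h0 h1 => ?_⟩
  set V := h • X with hV
  have hVn : ‖(1 / 2 : ℝ) • V‖ ≤ h * x := by
    rw [half_smul_norm, hV, norm_smul, Real.norm_eq_abs, abs_of_nonneg h0]
    have : h * ‖X‖ ≤ h * x := by gcongr
    have := mul_nonneg h0 (norm_nonneg X)
    linarith
  have hVx : ‖(1 / 2 : ℝ) • V‖ ≤ x := hVn.trans (by nlinarith)
  have hVhs : IsHS e V := hX.smul h
  have eq1 : exp V - 1 - V = ((eh V - 1) * evs shcC ((1 / 2 : ℝ) • V) +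
      (evs shcC ((1 / 2 : ℝ) • V) - 1)) * V := by
    rw [exp_sub_one]; noncomm_ring
  have b1 : ‖eh V - 1‖ ≤ Real.exp (2 * x) * (x * h) := by
    have a1 := exp_lip (e := e) (a := (1 / 2 : ℝ) • V) (b := 0) (R := x) (hVhs.smul _) (IsHS.zero e)
      hVx (by simpa using hx0)
    rw [NormedSpace.exp_zero, sub_zero] at a1
    refine (norm_le_hsNorm e (exp_sub_one_hs (hVhs.smul _))).trans (a1.trans ?_)
    gcongr
    rw [hsNorm_smul _ hVhs, hV, hsNorm_smul _ hX, abs_of_nonneg h0, ← hx,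
      abs_of_pos (by norm_num : (0 : ℝ) < 1 / 2)]
    have := mul_nonneg h0 hx0
    linarith
  have b2 : ‖evs shcC ((1 / 2 : ℝ) • V)‖ ≤ Real.exp x :=
    (evs_norm_le shcC_ok oneB _).trans (Real.exp_le_exp.2 hVx)
  have b3 : ‖evs shcC ((1 / 2 : ℝ) • V) - 1‖ ≤ Real.exp (2 * (x + 1)) * (x * h) := by
    have := evs_lipschitz shcC_ok oneB (S := (0 : H →L[ℂ] H)) (T := (1 / 2 : ℝ) • V) (R := x)
      (by simpa using hx0) hVx
    rw [evs_shc_zero, sub_zero] at this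
    refine this.trans ?_
    gcongr
    linarith
  rw [eq1]
  have h2 := hVhs.mul_left ((eh V - 1) * evs shcC ((1 / 2 : ℝ) • V) +
      (evs shcC ((1 / 2 : ℝ) • V) - 1))
  refine ⟨h2.1, h2.2.trans ?_⟩
  have h3 : hsNorm e V = h * x := by rw [hV, hsNorm_smul _ hX, abs_of_nonneg h0]
  rw [h3]
  calc _ ≤ (Real.exp (2 * x) * (x * h) * Real.exp x + Real.exp (2 * (x + 1)) * (x * h)) * (h * x) := by
        gcongr
        refine (norm_add_le _ _).trans (add_le_add ((norm_mul_le _ _).trans ?_) b3)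
        gcongr
    _ = _ := by ring

end Mostow


section Mostow2

set_option linter.unusedSectionVars false
open Filter Topology
open NormedSpace (exp)

/-- The `γ`-part of the Euler step. -/
theorem euler_gamma {e : HilbertBasis ι ℂ H} {E : Submodule ℝ (H →L[ℂ] H)}
    (hE : ∀ X ∈ E, MemS2 e X) (hclosed : IsHSClosed e (E : Set (H →L[ℂ] H)))
    (hbrk : ∀ X ∈ E, ∀ Y ∈ E, brk X (brk X Y) ∈ E) {X : H →L[ℂ] H} (hX : X ∈ E) {R : ℝ}
    (hR : 0 ≤ R) :
    ∃ C : ℝ, 0 ≤ C ∧ ∀ γ ∈ E, ‖γ‖ ≤ R → ∀ h : ℝ, 0 ≤ h → h ≤ 1 → ∃ γ' ∈ E,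
      IsHS e (exp γ' - exp γ - h • (X * exp γ + exp γ * X)) ∧
      hsNorm e (exp γ' - exp γ - h • (X * exp γ + exp γ * X)) ≤ C * h ^ 2 := by
  have hXhs : IsHS e X := (hE X hX).2
  set XX : HSO e := HSO.mk X hXhs with hXX
  set g : ℝ := 2 * Real.exp R * ‖XX‖ with hg
  have hg0 : 0 ≤ g := by positivity
  set R' : ℝ := R + g with hR'
  have hR'0 : 0 ≤ R' := by positivity
  refine ⟨(Real.exp (2 * R') * g) * (Real.exp R' * g) * Real.exp (R' / 2) +
    Real.exp (R' / 2) * (Real.exp (2 * (R' + 1)) * g * g) * Real.exp (R' / 2), by positivity, ?_⟩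
  intro γ hγ hγR h h0 h1
  have hγm := hE γ hγ
  set D := DH e γ γ with hD
  have hsym := DH_symm e hγm.1 hγm.1
  have hK := liftE_closed hE hclosed
  have hDD : ∀ M ∈ liftE e E, D (D M) ∈ liftE e E := by
    intro M hM
    rw [mem_liftE, hD, DH_sq_op]
    exact E.smul_mem _ (hbrk γ hγ _ hM)
  set F : HSO e := (2 : ℝ) • evs chcC D XX with hF
  have hFm : F ∈ liftE e E := (liftE e E).smul_mem _ (evs_mem chcC_ok hK hDD hX)
  have hDn : ‖D‖ ≤ R := (DH_norm e γ γ).trans (by linarith)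
  have hFn : ‖F‖ ≤ g := by
    rw [hF, norm_smul, hg, mul_assoc]
    refine mul_le_mul (by norm_num) ?_ (norm_nonneg _) (by norm_num)
    refine (ContinuousLinearMap.le_opNorm _ _).trans ?_
    gcongr
    exact (evs_norm_le chcC_ok clm_one_le D).trans (Real.exp_le_exp.2 hDn)
  obtain ⟨G, hG, hSG⟩ := solve_shc hsym hK hDD hFm
  have hGn : ‖G‖ ≤ g := by
    refine (shc_norm_ge hsym G).trans ?_
    rw [hSG]; exact hFn
  set Γ : HSO e := HSO.mk γ hγm.2 with hΓ
  set Γ' : HSO e := Γ + h • G with hΓ'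
  have hhG : ‖h • G‖ ≤ h * g := by
    rw [norm_smul, Real.norm_eq_abs, abs_of_nonneg h0]; gcongr
  have hγ'n : ‖Γ'.op‖ ≤ R' := by
    have a1 : Γ'.op = γ + (h • G).op := rfl
    rw [a1]
    refine (norm_add_le _ _).trans ?_
    have a2 := HSO.op_norm_le (h • G)
    have a3 : h * g ≤ 1 * g := by gcongr
    rw [hR']; linarith
  have hγR' : ‖γ‖ ≤ R' := by linarith
  have hsub : Γ' - Γ = h • G := by rw [hΓ']; abel
  have eA := exp_sub_exp e Γ' Γ
  rw [hsub] at eA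
  set DD := DH e Γ'.op γ with hDD'
  have eB : h • (X * exp γ + exp γ * X) = eh γ * (evs shcC D (h • G)).op * eh γ := by
    have c := chc_formula e γ γ XX
    rw [map_smul, hSG]
    change F.op = eh γ * X * ei γ + ei γ * X * eh γ at c
    rw [HSO.op_smul, c, mul_smul_comm, smul_mul_assoc]
    congr 1
    calc X * exp γ + exp γ * X
        = (eh γ * ei γ) * X * (eh γ * eh γ) + (eh γ * eh γ) * X * (ei γ * eh γ) := by
          rw [eh_mul_ei, eh_mul_eh, ei_mul_eh, one_mul, mul_one]
      _ = _ := by noncomm_ring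
  have eC : exp Γ'.op - exp γ - h • (X * exp γ + exp γ * X) =
      (eh Γ'.op - eh γ) * (evs shcC DD (h • G)).op * eh γ +
      eh γ * ((evs shcC DD - evs shcC D) (h • G)).op * eh γ := by
    rw [eB]
    change exp Γ'.op - exp Γ.op - _ = _
    rw [eA, sub_apply, HSO.op_sub]
    change eh Γ'.op * (evs shcC DD (h • G)).op * eh γ - _ = _
    noncomm_ring
  refine ⟨Γ'.op, E.add_mem hγ (E.smul_mem h hG), ?_⟩
  rw [eC]
  have n1 : ‖eh Γ'.op - eh γ‖ ≤ Real.exp (2 * R') * g * h := by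
    have hh1 : IsHS e ((1 / 2 : ℝ) • Γ'.op) := Γ'.hs.smul _
    have hh2 : IsHS e ((1 / 2 : ℝ) • γ) := hγm.2.smul _
    have a1 := exp_lip (R := R') hh1 hh2
      (by rw [half_smul_norm]; linarith [norm_nonneg Γ'.op])
      (by rw [half_smul_norm]; linarith [norm_nonneg γ])
    have a2 : IsHS e (eh Γ'.op - eh γ) := by
      have := (exp_sub_one_hs hh1).sub (exp_sub_one_hs hh2)
      rw [sub_sub_sub_cancel_right] at this
      exact this
    refine (norm_le_hsNorm e a2).trans (a1.trans ?_)
    rw [mul_assoc]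
    gcongr
    have a3 : (1 / 2 : ℝ) • Γ'.op - (1 / 2 : ℝ) • γ = (1 / 2 : ℝ) • (h • G).op := by
      rw [← hsub, ← smul_sub]; rfl
    rw [a3, hsNorm_smul _ (HSO.hs _), ← HSO.norm_def, abs_of_pos (by norm_num : (0 : ℝ) < 1 / 2)]
    have := mul_nonneg h0 hg0
    linarith
  have n2 : hsNorm e (evs shcC DD (h • G)).op ≤ Real.exp R' * (h * g) := by
    rw [← HSO.norm_def]
    refine (shcDH_norm e hγ'n hγR' _).trans ?_
    gcongr
  have n3 : hsNorm e ((evs shcC DD - evs shcC D) (h • G)).op ≤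
      Real.exp (2 * (R' + 1)) * (h * g) * (h * g) := by
    rw [← HSO.norm_def]
    refine (ContinuousLinearMap.le_opNorm _ _).trans ?_
    have d1 : ‖D‖ ≤ R' := hDn.trans (by linarith)
    have d2 : ‖DD‖ ≤ R' := (DH_norm e _ _).trans (by linarith)
    have d3 : ‖DD - D‖ ≤ h * g := by
      have : DD - D = lmH e ((1 / 2 : ℝ) • (h • G).op) := by
        ext1 M
        apply HSO.ext
        simp only [hDD', hD, DH, sub_apply, add_apply, HSO.op_sub, HSO.op_add, lmH_op, rmH_op]
        have : Γ'.op = γ + (h • G).op := rfl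
        rw [this, smul_add, add_mul]
        abel
      rw [this]
      refine (lmH_norm e _).trans ?_
      rw [half_smul_norm]
      have a2 := HSO.op_norm_le (h • G)
      have := mul_nonneg h0 hg0
      linarith
    have := evs_lipschitz shcC_ok clm_one_le d1 d2
    have h5 : ‖evs shcC DD - evs shcC D‖ ≤ Real.exp (2 * (R' + 1)) * (h * g) :=
      this.trans (by gcongr)
    gcongr
  have t1 := hs_three (HSO.hs _) n1 n2 (eh_norm hγR')
  have t2 := hs_three (HSO.hs _) (eh_norm hγR') n3 (eh_norm hγR')
  refine ⟨t1.1.add t2.1, (hsNorm_add_le t1.1 t2.1).trans ?_⟩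
  refine (add_le_add t1.2 t2.2).trans (le_of_eq ?_)
  ring

theorem euler_alg {A : Type*} [Ring A] (g' g Y Q : A) :
    g' - (1 + Y + Q) * g * (1 + Y + Q) = (g' - g - (Y * g + g * Y)) -
      ((1 * Y * (g * Y) + 1 * Q * (g * (1 + Y + Q))) + ((1 + Y) * g) * Q * 1) := by
  noncomm_ring

/-- One Euler step. -/
theorem euler_step {e : HilbertBasis ι ℂ H} {E : Submodule ℝ (H →L[ℂ] H)}
    (hE : ∀ X ∈ E, MemS2 e X) (hclosed : IsHSClosed e (E : Set (H →L[ℂ] H)))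
    (hbrk : ∀ X ∈ E, ∀ Y ∈ E, brk X (brk X Y) ∈ E) {X : H →L[ℂ] H} (hX : X ∈ E) {R : ℝ}
    (hR : 0 ≤ R) :
    ∃ C : ℝ, 0 ≤ C ∧ ∀ γ ∈ E, ‖γ‖ ≤ R → ∀ h : ℝ, 0 ≤ h → h ≤ 1 → ∃ γ' ∈ E,
      IsHS e (exp γ' - exp (h • X) * exp γ * exp (h • X)) ∧
      hsNorm e (exp γ' - exp (h • X) * exp γ * exp (h • X)) ≤ C * h ^ 2 := by
  obtain ⟨C1, hC1, H1⟩ := euler_gamma hE hclosed hbrk hX hR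
  have hXhs : IsHS e X := (hE X hX).2
  obtain ⟨C2, hC2, H2⟩ := exp_taylor hXhs
  set x := hsNorm e X with hx
  have hx0 : 0 ≤ x := hsNorm_nonneg e X
  have hXx : ‖X‖ ≤ x := norm_le_hsNorm e hXhs
  refine ⟨C1 + (x * x * Real.exp R + C2 * (Real.exp R * Real.exp x) + (1 + x) * Real.exp R * C2),
    by positivity, ?_⟩
  intro γ hγ hγR h h0 h1
  obtain ⟨γ', hγ', K1, K2⟩ := H1 γ hγ hγR h h0 h1
  refine ⟨γ', hγ', ?_⟩
  obtain ⟨Q1, Q2⟩ := H2 h h0 h1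
  set Q := exp (h • X) - 1 - h • X with hQ
  have hA : exp (h • X) = 1 + h • X + Q := by rw [hQ]; abel
  have hgn : ‖exp γ‖ ≤ Real.exp R := exp_normR hγR
  have hhX : ‖h • X‖ ≤ h * x := by
    rw [norm_smul, Real.norm_eq_abs, abs_of_nonneg h0]; gcongr
  have hhX1 : ‖h • X‖ ≤ x := hhX.trans (by nlinarith)
  have hAn : ‖exp (h • X)‖ ≤ Real.exp x := exp_normR hhX1
  have eq : exp γ' - exp (h • X) * exp γ * exp (h • X) =
      (exp γ' - exp γ - h • (X * exp γ + exp γ * X)) -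
      ((1 * (h • X) * (exp γ * (h • X)) + 1 * Q * (exp γ * exp (h • X))) +
        ((1 + h • X) * exp γ) * Q * 1) := by
    have e1 : h • (X * exp γ + exp γ * X) = (h • X) * exp γ + exp γ * (h • X) := by
      rw [smul_add, smul_mul_assoc, mul_smul_comm]
    rw [e1, hA]
    exact euler_alg _ _ _ _
  rw [eq]
  have hXn : hsNorm e (h • X) ≤ h * x := by
    rw [hsNorm_smul _ hXhs, abs_of_nonneg h0]
  have t1 := hs_three (hXhs.smul h) (oneB (H := H)) hXn (b := exp γ * (h • X))
    (t := Real.exp R * (h * x)) ((norm_mul_le _ _).trans (by gcongr))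
  have t2 := hs_three Q1 (oneB (H := H)) Q2 (b := exp γ * exp (h • X))
    (t := Real.exp R * Real.exp x) ((norm_mul_le _ _).trans (by gcongr))
  have t3 := hs_three Q1 (a := (1 + h • X) * exp γ) (r := (1 + x) * Real.exp R)
    ((norm_mul_le _ _).trans (by
      gcongr
      exact (norm_add_le _ _).trans (add_le_add oneB hhX1))) Q2 (oneB (H := H))
  have t12 := t1.1.add t2.1
  have t123 := t12.add t3.1
  refine ⟨K1.sub t123, ?_⟩
  rw [sub_eq_add_neg]
  refine (hsNorm_add_le K1 t123.neg).trans ?_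
  rw [hsNorm_neg]
  have a1 := hsNorm_add_le t12 t3.1
  have a2 := hsNorm_add_le t1.1 t2.1
  have a3 := t1.2
  have a4 := t2.2
  have a5 := t3.2
  have : C1 * h ^ 2 + (1 * (h * x) * (Real.exp R * (h * x)) +
      1 * (C2 * h ^ 2) * (Real.exp R * Real.exp x) + (1 + x) * Real.exp R * (C2 * h ^ 2) * 1) =
      (C1 + (x * x * Real.exp R + C2 * (Real.exp R * Real.exp x) + (1 + x) * Real.exp R * C2)) * h ^ 2 := by
    ring
  rw [← this]
  linarith

end Mostow2

section Mostow3

set_option linter.unusedSectionVars false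
open Filter Topology
open NormedSpace (exp)

theorem near_norm {γ x x' : H →L[ℂ] H} {M R : ℝ} (hγ : IsSelfAdjoint γ) (hM : 1 ≤ M) (hR : 0 ≤ R)
    (hMR : 2 * M ≤ Real.exp R) (h1 : x * x' = 1) (hx : ‖x‖ ≤ M) (hx' : ‖x'‖ ≤ M)
    (hd : ‖exp γ - x‖ ≤ 1 / (2 * M)) : ‖γ‖ ≤ R := by
  have hM2 : 1 / (2 * M) ≤ 1 := by
    rw [div_le_one (by positivity)]; linarith
  refine norm_le_of_exp hγ hR ?_ ?_
  · have : exp γ = x + (exp γ - x) := by abel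
    rw [this]
    refine (norm_add_le _ _).trans ?_
    linarith
  · have e1 : exp (-γ) = x' - exp (-γ) * (exp γ - x) * x' := by
      rw [mul_sub, rexp_neg_mul, sub_mul, one_mul, mul_assoc, h1, mul_one]; abel
    have e2 : ‖exp (-γ)‖ ≤ M + ‖exp (-γ)‖ * (1 / (2 * M)) * M := by
      calc ‖exp (-γ)‖ = ‖x' - exp (-γ) * (exp γ - x) * x'‖ := by rw [← e1]
        _ ≤ ‖x'‖ + ‖exp (-γ) * (exp γ - x) * x'‖ := norm_sub_le _ _
        _ ≤ ‖x'‖ + ‖exp (-γ)‖ * ‖exp γ - x‖ * ‖x'‖ := by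
          gcongr
          exact (norm_mul_le _ _).trans (by gcongr; exact norm_mul_le _ _)
        _ ≤ _ := by gcongr
    have e3 : ‖exp (-γ)‖ * (1 / (2 * M)) * M = ‖exp (-γ)‖ / 2 := by
      field_simp
    rw [e3] at e2
    linarith

/-- The curve `s ↦ e^{sX} e^Y e^{sX}`. -/
def mcurve (X Y : H →L[ℂ] H) (s : ℝ) : H →L[ℂ] H := exp (s • X) * exp Y * exp (s • X)

theorem mcurve_norm (X Y : H →L[ℂ] H) {s : ℝ} (h0 : 0 ≤ s) (h1 : s ≤ 1) :
    ‖mcurve X Y s‖ ≤ Real.exp (2 * ‖X‖ + ‖Y‖) := by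
  have h : ‖s • X‖ ≤ ‖X‖ := by
    rw [norm_smul, Real.norm_eq_abs, abs_of_nonneg h0]
    nlinarith [norm_nonneg X]
  have h2 := exp_normR h
  have h3 := exp_normR (le_refl ‖Y‖)
  have : Real.exp (2 * ‖X‖ + ‖Y‖) = Real.exp ‖X‖ * Real.exp ‖Y‖ * Real.exp ‖X‖ := by
    rw [← Real.exp_add, ← Real.exp_add]; ring_nf
  rw [this]
  exact (norm_mul_le _ _).trans (by gcongr; exact (norm_mul_le _ _).trans (by gcongr))

theorem mcurve_inv (X Y : H →L[ℂ] H) (s : ℝ) : mcurve X Y s * mcurve (-X) (-Y) s = 1 := by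
  unfold mcurve
  rw [smul_neg]
  calc _ = exp (s • X) * (exp Y * (exp (s • X) * exp (-(s • X))) * exp (-Y)) * exp (-(s • X)) := by
        noncomm_ring
    _ = 1 := by rw [rexp_mul_neg, mul_one, rexp_mul_neg, mul_one, rexp_mul_neg]

theorem mcurve_add (X Y : H →L[ℂ] H) (s h : ℝ) :
    mcurve X Y (s + h) = exp (h • X) * mcurve X Y s * exp (h • X) := by
  unfold mcurve
  rw [rexp_smul_add]
  nth_rw 1 [← rexp_smul_add s h X]
  rw [add_comm s h, rexp_smul_add]
  noncomm_ring

/-- Euler polygon stays in `exp E`, near the curve. -/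
theorem polygon {e : HilbertBasis ι ℂ H} {E : Submodule ℝ (H →L[ℂ] H)}
    (hE : ∀ X ∈ E, MemS2 e X) (hclosed : IsHSClosed e (E : Set (H →L[ℂ] H)))
    (hbrk : ∀ X ∈ E, ∀ Y ∈ E, brk X (brk X Y) ∈ E) {X Y : H →L[ℂ] H} (hX : X ∈ E) (hY : Y ∈ E) :
    ∃ K R : ℝ, ∀ ε > 0, ∃ γ ∈ E, ‖γ‖ ≤ R ∧ IsHS e (exp γ - mcurve X Y 1) ∧
      hsNorm e (exp γ - mcurve X Y 1) ≤ K * ε := by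
  set α := ‖X‖ with hα
  have hα0 : 0 ≤ α := norm_nonneg X
  set M := Real.exp (2 * α + ‖Y‖) with hM
  have hM1 : 1 ≤ M := Real.one_le_exp (by positivity)
  have hM0 : 0 < M := by linarith
  set R := 2 * α + ‖Y‖ + 1 with hR
  have hR0 : 0 ≤ R := by positivity
  have hMR : 2 * M ≤ Real.exp R := by
    rw [hR, Real.exp_add, ← hM, mul_comm]
    have := Real.add_one_le_exp (1 : ℝ)
    gcongr
    linarith
  obtain ⟨C, hC, hstep⟩ := euler_step hE hclosed hbrk hX hR0
  set K := C * Real.exp (2 * α) with hK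
  have hK0 : 0 ≤ K := by positivity
  refine ⟨K, R, fun ε hε => ?_⟩
  obtain ⟨n, hn⟩ := exists_nat_gt (max (max 1 (2 * M * K)) (1 / ε))
  have hn1 : (1 : ℝ) < n := lt_of_le_of_lt ((le_max_left _ _).trans (le_max_left _ _)) hn
  have hn2 : 2 * M * K < n := lt_of_le_of_lt ((le_max_right _ _).trans (le_max_left _ _)) hn
  have hn3 : 1 / ε < n := lt_of_le_of_lt (le_max_right _ _) hn
  have hn0 : (0 : ℝ) < n := by linarith
  set h : ℝ := 1 / n with hh
  have h0 : 0 < h := by positivity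
  have h1 : h ≤ 1 := by rw [hh, div_le_one hn0]; exact hn1.le
  have hnh : (n : ℝ) * h = 1 := by rw [hh]; field_simp
  have hKh : K * h ≤ 1 / (2 * M) := by
    rw [hh, mul_one_div, div_le_div_iff₀ hn0 (by positivity)]
    linarith
  have hkey : ∀ k : ℕ, (k : ℝ) * h ≤ 1 → ∀ c : ℝ,
      c ≤ k * C * h ^ 2 * Real.exp (2 * α * (k * h)) → c ≤ K * h := by
    intro k hk c hc
    refine hc.trans ?_
    have : (k : ℝ) * C * h ^ 2 * Real.exp (2 * α * (k * h)) =
      (C * Real.exp (2 * α * (k * h))) * h * (k * h) := by ring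
    rw [this]
    have h5 : Real.exp (2 * α * (k * h)) ≤ Real.exp (2 * α) :=
      Real.exp_le_exp.2 (by nlinarith)
    have h6 : C * Real.exp (2 * α * (k * h)) * h ≤ K * h := by rw [hK]; gcongr
    have h7 : 0 ≤ C * Real.exp (2 * α * (k * h)) * h := by positivity
    nlinarith
  have hbd : ∀ k : ℕ, (k : ℝ) * h ≤ 1 → ∀ γ ∈ E, IsHS e (exp γ - mcurve X Y (k * h)) →
      hsNorm e (exp γ - mcurve X Y (k * h)) ≤ K * h → ‖γ‖ ≤ R := by
    intro k hk γ hγ hs hle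
    have hkh : 0 ≤ (k : ℝ) * h := by positivity
    refine near_norm (hE γ hγ).1 hM1 hR0 hMR (mcurve_inv X Y (k * h)) (mcurve_norm X Y hkh hk) ?_
      ((norm_le_hsNorm e hs).trans (hle.trans hKh))
    have := mcurve_norm (-X) (-Y) hkh hk
    rwa [norm_neg, norm_neg] at this
  have main : ∀ k : ℕ, (k : ℝ) * h ≤ 1 → ∃ γ ∈ E, IsHS e (exp γ - mcurve X Y (k * h)) ∧
      hsNorm e (exp γ - mcurve X Y (k * h)) ≤ k * C * h ^ 2 * Real.exp (2 * α * (k * h)) := by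
    intro k
    induction k with
    | zero =>
      intro _
      refine ⟨Y, hY, ?_⟩
      have hz : exp Y - mcurve X Y ((0 : ℕ) * h) = 0 := by
        unfold mcurve; simp
      rw [hz]
      refine ⟨IsHS.zero e, ?_⟩
      simp [hsNorm]
    | succ k ih =>
      intro hk
      push_cast at hk ⊢
      have hk' : (k : ℝ) * h ≤ 1 := by nlinarith
      obtain ⟨γ, hγ, hs, hle⟩ := ih hk'
      have hγR := hbd k hk' γ hγ hs (hkey k hk' _ hle)
      obtain ⟨γ', hγ', s1, s2⟩ := hstep γ hγ hγR h h0.le h1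
      refine ⟨γ', hγ', ?_⟩
      have hhX : ‖h • X‖ ≤ h * α := by
        rw [norm_smul, Real.norm_eq_abs, abs_of_pos h0]
      have t := hs_three hs (exp_normR hhX) hle (exp_normR hhX)
      have eq : exp γ' - mcurve X Y ((k + 1) * h) =
          (exp γ' - exp (h • X) * exp γ * exp (h • X)) +
          exp (h • X) * (exp γ - mcurve X Y (k * h)) * exp (h • X) := by
        rw [add_mul, one_mul, mcurve_add]
        noncomm_ring
      rw [eq]
      refine ⟨s1.add t.1, (hsNorm_add_le s1 t.1).trans ((add_le_add s2 t.2).trans ?_)⟩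
      have e1 : Real.exp (2 * α * ((k + 1) * h)) =
          Real.exp (h * α) * Real.exp (2 * α * (k * h)) * Real.exp (h * α) := by
        rw [← Real.exp_add, ← Real.exp_add]; ring_nf
      have e2 : 1 ≤ Real.exp (2 * α * ((k + 1) * h)) := Real.one_le_exp (by positivity)
      have e3 : (k + 1) * C * h ^ 2 * Real.exp (2 * α * ((k + 1) * h)) =
          C * h ^ 2 * Real.exp (2 * α * ((k + 1) * h)) +
          k * C * h ^ 2 * Real.exp (2 * α * ((k + 1) * h)) := by ring
      rw [e3]
      refine add_le_add (le_mul_of_one_le_right (by positivity) e2) (le_of_eq ?_)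
      rw [e1]; ring
  obtain ⟨γ, hγ, hs, hle⟩ := main n hnh.le
  have hle' := hkey n hnh.le _ hle
  have hγR := hbd n hnh.le γ hγ hs hle'
  rw [hnh] at hs hle'
  refine ⟨γ, hγ, hγR, hs, hle'.trans ?_⟩
  gcongr
  rw [hh, div_le_iff₀ hn0]
  rw [div_lt_iff₀ hε] at hn3
  linarith

/-- Mostow: `e^X e^Y e^X ∈ exp E`. -/
theorem mostow {e : HilbertBasis ι ℂ H} {E : Submodule ℝ (H →L[ℂ] H)}
    (hE : ∀ X ∈ E, MemS2 e X) (hclosed : IsHSClosed e (E : Set (H →L[ℂ] H)))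
    (hbrk : ∀ X ∈ E, ∀ Y ∈ E, brk X (brk X Y) ∈ E) {X Y : H →L[ℂ] H} (hX : X ∈ E) (hY : Y ∈ E) :
    ∃ L ∈ E, exp L = exp X * exp Y * exp X := by
  have hP : MemP e (exp X * exp Y * exp X) := by
    have := memP_conj (g := exp X) (memP_exp (hE Y hY)) (rexp_isUnit X)
      (exp_sub_one_hs (hE X hX).2)
    rwa [(hE X hX).1.exp.star_eq] at this
  obtain ⟨L, hL, hLe⟩ := memP_iff hP
  refine ⟨L, ?_, hLe⟩
  obtain ⟨K, R, hpol⟩ := polygon hE hclosed hbrk hX hY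
  have hm : mcurve X Y 1 = exp L := by rw [hLe]; unfold mcurve; simp
  rw [hm] at hpol
  refine hclosed L hL fun ε hε => ?_
  set A := Real.exp (‖L‖ / 2) * |K| * Real.exp (R / 2) with hA
  have hA0 : 0 ≤ A := by positivity
  obtain ⟨γ, hγ, hγR, hs, hle⟩ := hpol (ε / (A + 1)) (by positivity)
  refine ⟨γ, hγ, ?_⟩
  have hl := log_lip e hL (hE γ hγ)
  change _ ≤ hsNorm e (eh L * ei γ - ei L * eh γ) at hl
  have eq : eh L * ei γ - ei L * eh γ = ei L * (-(exp γ - exp L)) * ei γ := by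
    rw [← ei_mul_exp L, ← exp_mul_ei γ]; noncomm_ring
  rw [eq] at hl
  have hle2 : hsNorm e (-(exp γ - exp L)) ≤ |K| * (ε / (A + 1)) := by
    rw [hsNorm_neg]
    refine hle.trans ?_
    gcongr
    exact le_abs_self K
  have t := hs_three hs.neg (ei_norm (le_refl ‖L‖)) hle2 (ei_norm hγR)
  refine lt_of_le_of_lt (hl.trans t.2) ?_
  have : Real.exp (‖L‖ / 2) * (|K| * (ε / (A + 1))) * Real.exp (R / 2) = A * ε / (A + 1) := by
    rw [hA]; ring
  rw [this, div_lt_iff₀ (by positivity)]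
  linarith

end Mostow3

section Proj

set_option linter.unusedSectionVars false
open Filter Topology
open NormedSpace (exp)

theorem exp_inj {V W : H →L[ℂ] H} (hV : IsSelfAdjoint V) (hW : IsSelfAdjoint W)
    (h : exp V = exp W) : V = W := by
  rw [← plog_exp hV, h, plog_exp hW]

theorem gdist_inv {e : HilbertBasis ι ℂ H} {k A B A' B' : H →L[ℂ] H} (hk : IsUnit k)
    (hA : MemS2 e A) (hB : MemS2 e B) (hA' : MemS2 e A')
    (h1 : k * exp A * star k = exp A') (h2 : k * exp B * star k = exp B') :
    gdist e (exp A') (exp B') = gdist e (exp A) (exp B) := by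
  obtain ⟨Z, hZ, -, h3, h4⟩ := gdist_Z hA hB
  have hs : star (k * eh A) = eh A * star k := by rw [star_mul, (eh_sa hA.1).star_eq]
  have h5 := gdist_eq (e := e) (V := A') (Z := Z) (k := k * eh A) hA'.1 hZ (hk.mul (eh_unit A)) (by
    rw [hs, ← h1, ← eh_mul_eh]; noncomm_ring)
  have h6 : k * eh A * exp Z * star (k * eh A) = exp B' := by
    rw [hs, ← h2, ← h3]; noncomm_ring
  rw [h6] at h5
  rw [h5, h4]

theorem gdist_zero {e : HilbertBasis ι ℂ H} {W : H →L[ℂ] H} (hW : MemS2 e W) :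
    gdist e (exp W) (exp 0) = hsNorm e W := by
  have h0 : MemS2 e (0 : H →L[ℂ] H) := ⟨IsSelfAdjoint.zero _, IsHS.zero e⟩
  obtain ⟨Z, hZ, h1, -, h2⟩ := gdist_Z hW h0
  rw [NormedSpace.exp_zero, mul_one, ei_mul_ei] at h1
  rw [h2, exp_inj hZ.1 hW.1.neg h1, hsNorm_neg]

/-- Semi-parallelogram law with midpoint in `exp E`. -/
theorem semi_par {e : HilbertBasis ι ℂ H} {E : Submodule ℝ (H →L[ℂ] H)}
    (hE : ∀ X ∈ E, MemS2 e X) (hclosed : IsHSClosed e (E : Set (H →L[ℂ] H)))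
    (hbrk : ∀ X ∈ E, ∀ Y ∈ E, brk X (brk X Y) ∈ E) {X Y V : H →L[ℂ] H} (hX : X ∈ E) (hY : Y ∈ E)
    (hV : MemS2 e V) :
    ∃ m ∈ E, gdist e (exp V) (exp m) ^ 2 ≤ 1 / 2 * gdist e (exp V) (exp X) ^ 2 +
      1 / 2 * gdist e (exp V) (exp Y) ^ 2 - 1 / 4 * hsNorm e (X - Y) ^ 2 := by
  have hX2 := hE X hX
  have hY2 := hE Y hY
  obtain ⟨Z, hZ, hZe, hZY, hd⟩ := gdist_Z hX2 hY2
  obtain ⟨L, hL, hLe⟩ := mostow hE hclosed hbrk (E.neg_mem (E.smul_mem (1 / 2 : ℝ) hX)) hY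
  have hZE : Z ∈ E := by
    have : Z = L := exp_inj hZ.1 (hE L hL).1 (by rw [hZe, hLe]; rfl)
    rw [this]; exact hL
  obtain ⟨m, hm, hme⟩ := mostow hE hclosed hbrk (E.smul_mem (1 / 2 : ℝ) hX)
    (E.smul_mem (1 / 2 : ℝ) hZE)
  set U := (1 / 2 : ℝ) • Z with hU
  have hU2 : MemS2 e U := hZ.smul _
  change exp m = eh X * exp U * eh X at hme
  have hUZ : exp U * exp U = exp Z := eh_mul_eh Z
  set k := eh X * eh U with hk
  have hku : IsUnit k := (eh_unit X).mul (eh_unit U)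
  have hsk : star k = eh U * eh X := by
    rw [hk, star_mul, (eh_sa hX2.1).star_eq, (eh_sa hU2.1).star_eq]
  have k0 : k * exp 0 * star k = exp m := by
    rw [hsk, NormedSpace.exp_zero, hme, ← eh_mul_eh U, hk]; noncomm_ring
  have kX : k * exp (-U) * star k = exp X := by
    rw [hsk, ← ei_mul_ei U, hk]
    calc _ = eh X * ((eh U * ei U) * (ei U * eh U)) * eh X := by noncomm_ring
      _ = _ := by rw [eh_mul_ei, ei_mul_eh, mul_one, mul_one, eh_mul_eh]
  have kY : k * exp U * star k = exp Y := by
    rw [hsk, ← hZY, ← hUZ, hk, ← eh_mul_eh U]; noncomm_ring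
  set j := ei U * ei X with hj
  have hju : IsUnit j := (ei_unit U).mul (ei_unit X)
  have hsj : star j = ei X * ei U := by
    rw [hj, star_mul, (ei_sa hX2.1).star_eq, (ei_sa hU2.1).star_eq]
  have hjs : IsHS e (j - 1) := by
    have : j - 1 = ei U * (ei X - 1) + (ei U - 1) := by rw [hj]; noncomm_ring
    rw [this]
    have a1 : IsHS e (ei X - 1) := exp_sub_one_hs (hX2.2.smul _).neg
    have a2 : IsHS e (ei U - 1) := exp_sub_one_hs (hU2.2.smul _).neg
    exact (a1.mul_left _).1.add a2
  obtain ⟨W, hW, hWe⟩ := memP_iff (memP_conj (memP_exp hV) hju hjs)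
  have kW : k * exp W * star k = exp V := by
    rw [hWe, hsk, hsj, hk, hj]
    calc _ = (eh X * ((eh U * ei U) * ei X)) * exp V * (ei X * (ei U * eh U) * eh X) := by
          noncomm_ring
      _ = _ := by
          rw [eh_mul_ei, ei_mul_eh, one_mul, mul_one, eh_mul_ei, ei_mul_eh, one_mul, mul_one]
  have h0 : MemS2 e (0 : H →L[ℂ] H) := ⟨IsSelfAdjoint.zero _, IsHS.zero e⟩
  refine ⟨m, hm, ?_⟩
  rw [gdist_inv hku hW h0 hV kW k0, gdist_inv hku hW hU2.neg hV kW kX,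
    gdist_inv hku hW hU2 hV kW kY, gdist_zero hW]
  have g1 := emi hW hU2.neg
  rw [sub_neg_eq_add] at g1
  have g2 := emi hW hU2
  have g3 := emi hX2 hY2
  rw [hd] at g3
  have g4 := hsNorm_parallelogram hW.2 hU2.2
  have g5 : hsNorm e U = 1 / 2 * hsNorm e Z := by
    rw [hU, hsNorm_smul _ hZ.2, abs_of_pos (by norm_num : (0 : ℝ) < 1 / 2)]
  rw [g5] at g4
  have q1 := pow_le_pow_left₀ (hsNorm_nonneg e _) g1 2
  have q2 := pow_le_pow_left₀ (hsNorm_nonneg e _) g2 2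
  have q3 := pow_le_pow_left₀ (hsNorm_nonneg e _) g3 2
  nlinarith

/-- Lower semicontinuity of the distance. -/
theorem gdist_lsc {e : HilbertBasis ι ℂ H} {V X : H →L[ℂ] H} {x : ℕ → H →L[ℂ] H} {c : ℝ}
    (hc : 0 ≤ c) (hV : MemS2 e V) (hX : MemS2 e X) (hx : ∀ n, MemS2 e (x n))
    (ht : Tendsto x atTop (𝓝 X)) (hb : ∀ᶠ n in atTop, gdist e (exp V) (exp (x n)) ≤ c) :
    gdist e (exp V) (exp X) ≤ c := by
  have hmem : ∀ Y, MemS2 e Y → MemP e (ei V * exp Y * ei V) := by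
    intro Y hY
    have := conj_mem hV.neg hY
    rwa [eh_neg] at this
  have hg : ∀ Y, gdist e (exp V) (exp Y) = hsNorm e (plog (ei V * exp Y * ei V)) := by
    intro Y
    unfold gdist; rw [pinvsqrt_exp hV.1]
  rw [hg]
  simp only [hg] at hb
  have h1 : Tendsto (fun n => ei V * exp (x n) * ei V) atTop (𝓝 (ei V * exp X * ei V)) := by
    have : Tendsto (fun n => exp (x n)) atTop (𝓝 (exp X)) :=
      (rexp_continuous.tendsto X).comp ht
    exact (this.const_mul _).mul_const _
  have h2 : Tendsto (fun n => plog (ei V * exp (x n) * ei V)) atTop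
      (𝓝 (plog (ei V * exp X * ei V))) := by
    have hcont := CFC.continuousOn_log (A := H →L[ℂ] H) (ei V * exp X * ei V)
      ⟨(hmem X hX).1, (hmem X hX).2.1⟩
    refine Tendsto.comp hcont (tendsto_nhdsWithin_iff.2 ⟨h1, Eventually.of_forall fun n => ?_⟩)
    exact ⟨(hmem _ (hx n)).1, (hmem _ (hx n)).2.1⟩
  exact (hs_fatou e hc h2 (Eventually.of_forall fun n => plog_hs (hmem _ (hx n))) hb).2

end Proj

/-- If `E` is a closed subspace of `S₂(H)` with `[X,[X,Y]] ∈ E` for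
all `X, Y ∈ E`, then every `p ∈ P` has a unique nearest point in `exp E` for the
geodesic distance. -/
theorem statement12 (e : HilbertBasis ι ℂ H) (E : Submodule ℝ (H →L[ℂ] H))
    (hE : ∀ X ∈ E, MemS2 e X) (hclosed : IsHSClosed e (E : Set (H →L[ℂ] H)))
    (hbrk : ∀ X ∈ E, ∀ Y ∈ E, brk X (brk X Y) ∈ E)
    (p : H →L[ℂ] H) (hp : MemP e p) :
    ∃! q : H →L[ℂ] H, q ∈ expSet (E : Set (H →L[ℂ] H)) ∧
      gdist e p q = sInf (gdist e p '' expSet (E : Set (H →L[ℂ] H))) := by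
  obtain ⟨V, hV, rfl⟩ := memP_iff hp
  set S := gdist e (NormedSpace.exp V) '' expSet (E : Set (H →L[ℂ] H)) with hS
  set I := sInf S with hI
  have hbdd : BddBelow S := ⟨0, by
    rintro _ ⟨q, -, rfl⟩
    exact hsNorm_nonneg e _⟩
  have hmemS : ∀ X ∈ E, gdist e (NormedSpace.exp V) (NormedSpace.exp X) ∈ S :=
    fun X hX => ⟨_, ⟨X, hX, rfl⟩, rfl⟩
  have hne : S.Nonempty := ⟨_, hmemS 0 E.zero_mem⟩
  have hI0 : 0 ≤ I := by
    refine Real.sInf_nonneg ?_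
    rintro _ ⟨q, -, rfl⟩
    exact hsNorm_nonneg e _
  have hIle : ∀ X ∈ E, I ≤ gdist e (NormedSpace.exp V) (NormedSpace.exp X) :=
    fun X hX => csInf_le hbdd (hmemS X hX)
  have key : ∀ X ∈ E, ∀ Y ∈ E, ∀ δ : ℝ, 0 ≤ δ →
      gdist e (NormedSpace.exp V) (NormedSpace.exp X) ≤ I + δ →
      gdist e (NormedSpace.exp V) (NormedSpace.exp Y) ≤ I + δ →
      hsNorm e (X - Y) ^ 2 ≤ 4 * (2 * I * δ + δ ^ 2) := by
    intro X hX Y hY δ hδ h1 h2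
    obtain ⟨m, hm, hle⟩ := semi_par hE hclosed hbrk hX hY hV
    have h3 := pow_le_pow_left₀ hI0 (hIle m hm) 2
    have h4 := pow_le_pow_left₀ (hI0.trans (hIle X hX)) h1 2
    have h5 := pow_le_pow_left₀ (hI0.trans (hIle Y hY)) h2 2
    nlinarith
  have hex : ∀ n : ℕ, ∃ X ∈ E,
      gdist e (NormedSpace.exp V) (NormedSpace.exp X) < I + 1 / ((n : ℝ) + 1) := by
    intro n
    obtain ⟨_, ⟨_, ⟨X, hX, rfl⟩, rfl⟩, hlt⟩ :=
      exists_lt_of_csInf_lt hne (show sInf S < I + 1 / ((n : ℝ) + 1) by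
        rw [← hI]; have : (0 : ℝ) < 1 / ((n : ℝ) + 1) := by positivity
        linarith)
    exact ⟨X, hX, hlt⟩
  choose x hxE hx using hex
  have hxN : ∀ N n : ℕ, N ≤ n →
      gdist e (NormedSpace.exp V) (NormedSpace.exp (x n)) ≤ I + 1 / ((N : ℝ) + 1) := by
    intro N n hn
    have : 1 / ((n : ℝ) + 1) ≤ 1 / ((N : ℝ) + 1) := by
      have : (N : ℝ) ≤ n := by exact_mod_cast hn
      gcongr
    linarith [hx n]
  obtain ⟨X, hXhs, hXt, hXc⟩ := hs_cauchy_limit e (A := x) (fun n => (hE _ (hxE n)).2) (by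
    intro ε hε
    obtain ⟨N, hN⟩ := exists_nat_gt (4 * (2 * I + 1) / ε ^ 2)
    refine ⟨N, fun m hm n hn => ?_⟩
    have hδ : (0 : ℝ) < 1 / ((N : ℝ) + 1) := by positivity
    have h1 := key _ (hxE m) _ (hxE n) _ hδ.le (hxN N m hm) (hxN N n hn)
    have hδ1 : 1 / ((N : ℝ) + 1) ≤ 1 := by
      rw [div_le_one (by positivity)]
      have : (0 : ℝ) ≤ N := by positivity
      linarith
    have h2 : 4 * (2 * I + 1) * (1 / ((N : ℝ) + 1)) < ε ^ 2 := by
      rw [mul_one_div, div_lt_iff₀ (by positivity)]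
      rw [div_lt_iff₀ (by positivity)] at hN
      nlinarith [pow_pos hε 2]
    refine lt_of_pow_lt_pow_left₀ 2 hε.le (lt_of_le_of_lt h1 ?_)
    nlinarith)
  have hXsa : IsSelfAdjoint X := by
    refine tendsto_nhds_unique ((continuous_star.tendsto X).comp hXt) ?_
    refine hXt.congr fun n => ?_
    exact (hE _ (hxE n)).1.star_eq.symm
  have hX2 : MemS2 e X := ⟨hXsa, hXhs⟩
  have hXE : X ∈ E := hclosed X hX2 fun ε hε => by
    obtain ⟨N, hN⟩ := hXc (ε / 2) (by linarith)
    exact ⟨x N, hxE N, lt_of_le_of_lt (hN N le_rfl) (by linarith)⟩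
  have hXI : gdist e (NormedSpace.exp V) (NormedSpace.exp X) = I := by
    refine le_antisymm (le_of_forall_pos_le_add fun ε hε => ?_) (hIle X hXE)
    obtain ⟨N, hN⟩ := exists_nat_one_div_lt hε
    refine gdist_lsc (by linarith) hV hX2 (fun n => hE _ (hxE n)) hXt ?_
    filter_upwards [Filter.eventually_ge_atTop N] with n hn
    linarith [hxN N n hn]
  refine ⟨NormedSpace.exp X, ⟨⟨X, hXE, rfl⟩, hXI⟩, ?_⟩
  rintro _ ⟨⟨Y, hY, rfl⟩, hYI⟩
  have h := key Y hY X hXE 0 le_rfl (by rw [add_zero]; exact hYI.le) (by rw [add_zero]; exact hXI.le)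
  have h0 : hsNorm e (Y - X) = 0 := by
    have := hsNorm_nonneg e (Y - X)
    nlinarith
  have := hsNorm_eq_zero ((hE Y hY).2.sub hXhs) h0
  rw [sub_eq_zero.1 this]
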